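/- arXiv:0810.2091 — 2 statements merged into one kernel-verified Lean document; each statement's English description precedes it below -/
import Mathlib

section
/- Let m be a positive integer and, for i = 1, 2, let H_i be an infinite-dimensional separable complex Hilbert space and M_i a commutative von Neumann subalgebra of the bounded operators on H_i such that: (1) M_i contains no minimal projection (i.e., there is no nonzero orthogonal projection p ∈ M_i such that every orthogonal projection q ∈ M_i with qp = q equals 0 or p), and (2) the commutant M_i′ of M_i is *-isomorphic to the algebra of m×m matrices over M_i. Then there exists a unitary operator U : H₁ → H₂ such that U M₁ U* = M₂. -/
noncomputable section


/-- `M` contains no minimal projection: there is no nonzero orthogonal projection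
`p ∈ M` such that every orthogonal projection `q ∈ M` with `q * p = q` equals `0` or
`p`. -/
def HasNoMinimalProjection {H : Type} [NormedAddCommGroup H] [InnerProductSpace ℂ H]
    [CompleteSpace H] (M : VonNeumannAlgebra H) : Prop :=
  ¬ ∃ p : H →L[ℂ] H, p ∈ M ∧ p ≠ 0 ∧ IsIdempotentElem p ∧ IsSelfAdjoint p ∧
      ∀ q ∈ M, IsIdempotentElem q → IsSelfAdjoint q → q * p = q → q = 0 ∨ q = p



section S7
variable {H : Type} [NormedAddCommGroup H] [InnerProductSpace ℂ H] [CompleteSpace H]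

/-- orthogonal projections of `M` -/
def IsPr (M : VonNeumannAlgebra H) (e : H →L[ℂ] H) : Prop :=
  e ∈ M ∧ e * e = e ∧ star e = e

theorem s7_mem_of_comm {M : VonNeumannAlgebra H} {a : H →L[ℂ] H}
    (h : ∀ y ∈ M.commutant, y * a = a * y) : a ∈ M := by
  rw [← M.commutant_commutant]
  exact VonNeumannAlgebra.mem_commutant_iff.2 h

theorem s7_smul_mem {M : VonNeumannAlgebra H} {a : H →L[ℂ] H} (c : ℂ) (h : a ∈ M) :
    c • a ∈ M := by
  have : c • a ∈ M.toStarSubalgebra := M.toStarSubalgebra.smul_mem h c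
  exact this

theorem s7_proj_mem (M : VonNeumannAlgebra H) (K : Submodule ℂ H) [K.HasOrthogonalProjection]
    (h : ∀ y ∈ M.commutant, ∀ x ∈ K, y x ∈ K) : IsPr M K.starProjection := by
  have hs : IsStarProjection K.starProjection := isStarProjection_starProjection
  refine ⟨?_, hs.1, hs.2⟩
  rw [VonNeumannAlgebra.IsStarProjection.mem_iff hs]
  intro y hy
  rw [Module.End.mem_invtSubmodule_iff_forall_mem_of_mem]
  intro x hx
  simp only [Submodule.range_starProjection] at hx ⊢
  exact h y hy x hx

theorem s7_cfc_mem (M : VonNeumannAlgebra H) {a : H →L[ℂ] H} (ha : a ∈ M) (f : ℝ → ℝ) :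
    cfc f a ∈ M := by
  apply s7_mem_of_comm
  intro y hy
  have : Commute a y := VonNeumannAlgebra.mem_commutant_iff.1 hy a ha
  exact (this.cfc_real f).symm

theorem s7_range_proj (M : VonNeumannAlgebra H) {g : H →L[ℂ] H} (hg : g ∈ M) :
    ∃ p, IsPr M p ∧ p * g = g ∧ ∀ h : H →L[ℂ] H, h * g = 0 → h * p = 0 := by
  let K : Submodule ℂ H := (LinearMap.range (g : H →ₗ[ℂ] H)).topologicalClosure
  have hK : IsClosed (K : Set H) := Submodule.isClosed_topologicalClosure _
  have : CompleteSpace K := hK.completeSpace_coe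
  refine ⟨K.starProjection, s7_proj_mem M K ?_, ?_, ?_⟩
  · intro y hy x hx
    have hc := VonNeumannAlgebra.mem_commutant_iff.1 hy g hg
    refine map_mem_closure (t := ((LinearMap.range (g : H →ₗ[ℂ] H)) : Set H))
      y.continuous hx ?_
    rintro _ ⟨z, rfl⟩
    exact ⟨y z, congr($hc z)⟩
  · ext x
    exact Submodule.starProjection_eq_self_iff.2 (Submodule.le_topologicalClosure _ ⟨x, rfl⟩)
  · intro h hh
    have : K ≤ LinearMap.ker (h : H →ₗ[ℂ] H) := by
      apply Submodule.topologicalClosure_minimal _ _ h.isClosed_ker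
      rintro _ ⟨z, rfl⟩
      exact congr($hh z)
    ext x
    exact this (Submodule.starProjection_apply_mem K x)

theorem s7_half (M : VonNeumannAlgebra H) {a : H →L[ℂ] H} (ha : a ∈ M)
    (hs : IsSelfAdjoint a) :
    ∃ b ∈ Submodule.span ℂ {e | IsPr M e}, b ∈ M ∧ IsSelfAdjoint b ∧ ‖a - b‖ ≤ ‖a‖ / 2 := by
  set g := cfc (fun x : ℝ => max x 0) a with hg
  set h := cfc (fun x : ℝ => max (-x) 0) a with hh
  set c : ℝ := ‖a‖ / 2 with hc
  have hgh : g - h = a := by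
    rw [hg, hh, ← cfc_sub ..]
    conv_rhs => rw [← cfc_id ℝ a]
    congr 1; ext x
    rcases le_total x 0 with hx | hx <;> simp [hx]
  have hgh0 : h * g = 0 := by
    rw [hg, hh, ← cfc_mul ..]
    have : (fun x : ℝ => max (-x) 0 * max x 0) = fun _ => 0 := by
      ext x
      rcases le_total x 0 with hx | hx <;> simp [hx]
    rw [this, cfc_const_zero]
  have hgs : star g = g := by
    exact cfc_predicate (R := ℝ) (p := IsSelfAdjoint) _ a
  obtain ⟨p, hp, hpg, hp0⟩ := s7_range_proj M (s7_cfc_mem M ha _ : g ∈ M)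
  have hhp := hp0 h hgh0
  have hgp : g * p = g := by
    have := congr(star $hpg)
    rwa [← hg, star_mul, hgs, hp.2.2] at this
  have hsum : g + h - algebraMap ℝ _ c = cfc (fun x : ℝ => |x| - c) a := by
    have : (fun x : ℝ => |x| - c) = fun x => (max x 0 + max (-x) 0) - c := by
      ext x
      rcases le_total x 0 with hx | hx <;> simp [hx, abs_of_nonneg, abs_of_nonpos]
    rw [this, cfc_sub .., cfc_add .., cfc_const c a]
  set u : H →L[ℂ] H := p + p - 1 with hu
  have hus : star u = u := by simp [hu, hp.2.2]
  have hpp := hp.2.1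
  have huu : u * u = 1 := by
    simp only [hu, sub_mul, mul_sub, add_mul, mul_add, hpp, one_mul, mul_one]
    abel
  have hun : ‖u‖ ≤ 1 := by
    have h1 : ‖star u * u‖ = ‖u‖ * ‖u‖ := CStarRing.norm_star_mul_self
    rw [hus, huu] at h1
    have h2 : ‖(1 : H →L[ℂ] H)‖ ≤ 1 := ContinuousLinearMap.norm_id_le
    nlinarith [norm_nonneg u]
  refine ⟨(c : ℂ) • u, ?_, ?_, ?_, ?_⟩
  · refine Submodule.smul_mem _ _ (sub_mem ?_ ?_)
    · exact add_mem (Submodule.subset_span hp) (Submodule.subset_span hp)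
    · exact Submodule.subset_span ⟨one_mem M, by simp, by simp⟩
  · exact s7_smul_mem _ (sub_mem (add_mem hp.1 hp.1) (one_mem M))
  · rw [IsSelfAdjoint, star_smul, hus]; simp
  · have : a - (c : ℂ) • u = (g + h - algebraMap ℝ _ c) * u := by
      have e1 : (g + h) * u = a := by
        rw [← hgh]
        simp only [hu, add_mul, mul_sub, mul_add, hgp, hhp, mul_one]
        abel
      rw [sub_mul, e1, Algebra.algebraMap_eq_smul_one, smul_mul_assoc, one_mul]
      simp
    rw [this]
    refine (norm_mul_le _ _).trans ?_
    have hc0 : 0 ≤ c := by positivity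
    have : ‖g + h - algebraMap ℝ _ c‖ ≤ c := by
      rw [hsum]
      apply norm_cfc_le hc0
      intro x hx
      have := spectrum.norm_le_norm_mul_of_mem hx
      have h2 : ‖(1 : H →L[ℂ] H)‖ ≤ 1 := ContinuousLinearMap.norm_id_le
      replace this : ‖x‖ ≤ ‖a‖ := this.trans (by nlinarith [norm_nonneg a])
      rw [Real.norm_eq_abs] at this
      rw [Real.norm_eq_abs, abs_le]
      constructor <;> linarith [abs_nonneg x]
    calc _ ≤ c * 1 := by gcongr
      _ = c := mul_one c

theorem s7_span_dense (M : VonNeumannAlgebra H) {a : H →L[ℂ] H} (ha : a ∈ M) :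
    a ∈ (Submodule.span ℂ {e | IsPr M e}).topologicalClosure := by
  have key : ∀ (n : ℕ) (a : H →L[ℂ] H), a ∈ M → IsSelfAdjoint a →
      ∃ b ∈ Submodule.span ℂ {e | IsPr M e}, ‖a - b‖ ≤ ‖a‖ / 2 ^ n := by
    intro n
    induction n with
    | zero => intro a _ _; exact ⟨0, zero_mem _, by simp⟩
    | succ n ih =>
      intro a ha hs
      obtain ⟨b, hb, hbM, hbs, hab⟩ := s7_half M ha hs
      obtain ⟨d, hd, hd'⟩ := ih (a - b) (sub_mem ha hbM) (hs.sub hbs)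
      refine ⟨b + d, add_mem hb hd, ?_⟩
      rw [← sub_sub]
      refine hd'.trans ?_
      rw [pow_succ', ← div_div]
      gcongr
  have key2 : ∀ (a : H →L[ℂ] H), a ∈ M → IsSelfAdjoint a →
      a ∈ (Submodule.span ℂ {e | IsPr M e}).topologicalClosure := by
    intro a ha hs
    rw [← SetLike.mem_coe, Submodule.topologicalClosure_coe, Metric.mem_closure_iff]
    intro ε hε
    have ht : Filter.Tendsto (fun n : ℕ => ‖a‖ / 2 ^ n) Filter.atTop (nhds 0) := by
      have := (tendsto_pow_atTop_nhds_zero_of_lt_one (r := (1/2 : ℝ)) (by norm_num) (by norm_num)).const_mul ‖a‖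
      simpa [div_eq_mul_inv] using this
    obtain ⟨n, hn⟩ := (ht.eventually (gt_mem_nhds hε)).exists
    obtain ⟨b, hb, hb'⟩ := key n a ha hs
    exact ⟨b, hb, by rw [dist_eq_norm]; exact hb'.trans_lt hn⟩
  have h1 : a = (1/2 : ℂ) • (a + star a) + (Complex.I / 2) • (Complex.I • (star a - a)) := by
    rw [smul_smul, div_mul_eq_mul_div, Complex.I_mul_I]
    module
  rw [h1]
  refine add_mem (Submodule.smul_mem _ _ (key2 _ (add_mem ha (star_mem ha)) ?_))
    (Submodule.smul_mem _ _ (key2 _ (s7_smul_mem _ (sub_mem (star_mem ha) ha)) ?_))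
  · simp [IsSelfAdjoint, add_comm]
  · simp only [IsSelfAdjoint, star_smul, star_sub, star_star]
    simp [← smul_neg]

end S7

section S7b
variable {H : Type} [NormedAddCommGroup H] [InnerProductSpace ℂ H] [CompleteSpace H]

/-- closed `M`-invariant subspace generated by `S` -/
def cyc (M : VonNeumannAlgebra H) (S : Set H) : Submodule ℂ H :=
  (Submodule.span ℂ {y | ∃ a ∈ M, ∃ x ∈ S, y = a x}).topologicalClosure

theorem cyc_closed (M : VonNeumannAlgebra H) (S : Set H) : IsClosed (cyc M S : Set H) :=
  Submodule.isClosed_topologicalClosure _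

instance (M : VonNeumannAlgebra H) (S : Set H) : CompleteSpace (cyc M S) :=
  (cyc_closed M S).completeSpace_coe

theorem cyc_subset (M : VonNeumannAlgebra H) {S : Set H} {x : H} (hx : x ∈ S) : x ∈ cyc M S :=
  Submodule.le_topologicalClosure _ (Submodule.subset_span ⟨1, one_mem M, x, hx, rfl⟩)

theorem cyc_le (M : VonNeumannAlgebra H) {S : Set H} {W : Submodule ℂ H}
    (hW : IsClosed (W : Set H)) (h : ∀ a ∈ M, ∀ x ∈ S, a x ∈ W) : cyc M S ≤ W := by
  apply Submodule.topologicalClosure_minimal _ _ hW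
  rw [Submodule.span_le]
  rintro _ ⟨a, ha, x, hx, rfl⟩
  exact h a ha x hx

theorem cyc_inv (M : VonNeumannAlgebra H) {S : Set H} {a : H →L[ℂ] H} (ha : a ∈ M) {x : H}
    (hx : x ∈ cyc M S) : a x ∈ cyc M S := by
  have : cyc M S ≤ (cyc M S).comap (a : H →ₗ[ℂ] H) := by
    apply cyc_le
    · exact (cyc_closed M S).preimage a.continuous
    · intro b hb x hx
      exact Submodule.le_topologicalClosure _
        (Submodule.subset_span ⟨a * b, mul_mem ha hb, x, hx, rfl⟩)
  exact this hx

theorem cyc_pr (M : VonNeumannAlgebra H) (S : Set H) : IsPr M.commutant (cyc M S).starProjection := by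
  apply s7_proj_mem
  intro y hy x hx
  rw [VonNeumannAlgebra.commutant_commutant] at hy
  exact cyc_inv M hy hx

theorem s7_cyclic (M : VonNeumannAlgebra H) [TopologicalSpace.SeparableSpace H]
    {p : H →L[ℂ] H} (hp : IsPr M.commutant p)
    (hab : ∀ x ∈ M.commutant, ∀ y ∈ M.commutant,
      (p * x * p) * (p * y * p) = (p * y * p) * (p * x * p)) :
    ∃ ξ, p ξ = ξ ∧ ∀ x, p x = x → x ∈ cyc M {ξ} := by
  have hpc : ∀ a ∈ M, ∀ x, a (p x) = p (a x) := fun a ha x =>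
    congr($(VonNeumannAlgebra.mem_commutant_iff.1 hp.1 a ha) x)
  have hpp : ∀ x, p (p x) = p x := fun x => congr($(hp.2.1) x)
  -- range of p
  have hRc : IsClosed ((LinearMap.eqLocus (p : H →ₗ[ℂ] H) LinearMap.id : Submodule ℂ H) : Set H) :=
    isClosed_eq p.continuous continuous_id
  have hle : ∀ S : Set H, (∀ x ∈ S, p x = x) → p * (cyc M S).starProjection = (cyc M S).starProjection
      ∧ (cyc M S).starProjection * p = (cyc M S).starProjection := by
    intro S hS
    have h1 : cyc M S ≤ (LinearMap.eqLocus (p : H →ₗ[ℂ] H) LinearMap.id : Submodule ℂ H) := by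
      apply cyc_le M hRc
      intro a ha x hx
      change p (a x) = a x
      rw [← hpc a ha, hS x hx]
    have h2 : p * (cyc M S).starProjection = (cyc M S).starProjection := by
      ext x
      exact h1 (Submodule.starProjection_apply_mem _ x)
    refine ⟨h2, ?_⟩
    have := congr(star $h2)
    rwa [star_mul, (cyc_pr M S).2.2, hp.2.2] at this
  have hcm : ∀ S T : Set H, (∀ x ∈ S, p x = x) → (∀ x ∈ T, p x = x) →
      (cyc M S).starProjection * (cyc M T).starProjection =
      (cyc M T).starProjection * (cyc M S).starProjection := by
    intro S T hS hT
    have := hab _ (cyc_pr M S).1 _ (cyc_pr M T).1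
    rwa [(hle S hS).1, (hle S hS).2, (hle T hT).1, (hle T hT).2] at this
  set d := TopologicalSpace.denseSeq H
  set x : ℕ → H := fun n => p (d n) with hx
  set S : ℕ → Set H := fun n => x '' {k | k < n} with hS
  have hSp : ∀ n, ∀ y ∈ S n, p y = y := by
    rintro n _ ⟨k, _, rfl⟩
    exact hpp _
  set P : ℕ → (H →L[ℂ] H) := fun n => (cyc M (S n)).starProjection with hP
  have hmono : ∀ {i j : ℕ}, i ≤ j → cyc M (S i) ≤ cyc M (S j) := by
    intro i j hij
    apply cyc_le M (cyc_closed _ _)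
    rintro a ha _ ⟨k, hk, rfl⟩
    exact cyc_inv M ha (cyc_subset M ⟨k, lt_of_lt_of_le hk hij, rfl⟩)
  have hPmem : ∀ n y, P n y ∈ cyc M (S n) := fun n y => Submodule.starProjection_apply_mem _ y
  have hPfix : ∀ n y, y ∈ cyc M (S n) → P n y = y := fun n y hy =>
    Submodule.starProjection_eq_self_iff.2 hy
  have hPP : ∀ i j, i ≤ j → ∀ y, P i (P j y) = P i y := by
    intro i j hij y
    have h1 : P j * P i = P i := by
      ext z; exact hPfix j _ (hmono hij (hPmem i z))
    have h2 := congr(star $h1)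
    rw [star_mul, (cyc_pr M (S i)).2.2, (cyc_pr M (S j)).2.2] at h2
    exact congr($h2 y)
  set η : ℕ → H := fun n => x n - P n (x n) with hη
  have hηmem : ∀ n, η n ∈ cyc M (S (n+1)) := fun n =>
    sub_mem (cyc_subset M ⟨n, Nat.lt_succ_self n, rfl⟩) (hmono (Nat.le_succ n) (hPmem n _))
  have hη0 : ∀ n, P n (η n) = 0 := by
    intro n
    simp only [hη, map_sub]
    rw [hPP n n le_rfl, sub_self]
  have hr : ∀ n k, (P (n+1) - P n) (η k) = if k = n then η n else 0 := by
    intro n k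
    rcases lt_trichotomy k n with h | h | h
    · have h1 : η k ∈ cyc M (S n) := hmono h (hηmem k)
      rw [if_neg h.ne, sub_apply, hPfix n _ h1,
        hPfix (n+1) _ (hmono (Nat.le_succ n) h1), sub_self]
    · subst h
      rw [if_pos rfl, sub_apply, hη0, hPfix _ _ (hηmem k), sub_zero]
    · rw [if_neg h.ne', sub_apply, ← hPP n k h.le, ← hPP (n+1) k h, hη0]
      simp
  set c : ℕ → ℝ := fun k => (1/2) ^ k / (1 + ‖η k‖) with hc
  have hc0 : ∀ k, c k ≠ 0 := fun k => by positivity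
  have hsum : Summable (fun k => (c k : ℂ) • η k) := by
    apply Summable.of_norm_bounded (g := fun k : ℕ => (1/2 : ℝ)^k)
      (summable_geometric_of_lt_one (by norm_num) (by norm_num))
    intro k
    have : 0 ≤ c k := by positivity
    rw [norm_smul, Complex.norm_real, Real.norm_of_nonneg this, hc]
    simp only
    rw [div_mul_eq_mul_div, div_le_iff₀ (by positivity)]
    gcongr
    linarith
  set ξ := ∑' k, (c k : ℂ) • η k with hξ
  have hrξ : ∀ n, (P (n+1) - P n) ξ = (c n : ℂ) • η n := by
    intro n
    rw [hξ, ContinuousLinearMap.map_tsum _ hsum, tsum_eq_single n]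
    · rw [map_smul, hr, if_pos rfl]
    · intro k hk
      rw [map_smul, hr, if_neg hk, smul_zero]
  have hpx : ∀ n, p (x n) = x n := fun n => hpp _
  have hpη : ∀ n, p (η n) = η n := by
    intro n
    simp only [hη, map_sub, hpx]
    congr 1
    exact congr($((hle (S n) (hSp n)).1) (x n))
  have hpξ : p ξ = ξ := by
    rw [hξ, ContinuousLinearMap.map_tsum _ hsum]
    simp only [map_smul, hpη]
  refine ⟨ξ, hpξ, ?_⟩
  have hξS : ∀ y ∈ ({ξ} : Set H), p y = y := by rintro _ rfl; exact hpξ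
  have hηW : ∀ n, η n ∈ cyc M {ξ} := by
    intro n
    have hcomm : (cyc M {ξ}).starProjection * (P (n+1) - P n) =
        (P (n+1) - P n) * (cyc M {ξ}).starProjection := by
      rw [mul_sub, sub_mul, hcm _ _ hξS (hSp n), hcm _ _ hξS (hSp (n+1))]
    have h1 := congr($hcomm ξ)
    rw [mul_apply_eq_comp, mul_apply_eq_comp, hrξ,
      Submodule.starProjection_eq_self_iff.2 (cyc_subset M rfl : ξ ∈ cyc M {ξ}), hrξ] at h1
    have h2 := Submodule.starProjection_eq_self_iff.1 h1
    exact (Submodule.smul_mem_iff _ (by exact_mod_cast hc0 n)).1 h2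
  have hxW : ∀ n, x n ∈ cyc M {ξ} := by
    intro n
    induction n using Nat.strong_induction_on with
    | _ n ih =>
      have : cyc M (S n) ≤ cyc M {ξ} := by
        apply cyc_le M (cyc_closed _ _)
        rintro a ha _ ⟨k, hk, rfl⟩
        exact cyc_inv M ha (ih k hk)
      have h2 : x n = η n + P n (x n) := by simp [hη]
      rw [h2]
      exact add_mem (hηW n) (this (hPmem n _))
  intro y hy
  rw [← hy]
  have hden : y ∈ closure (Set.range d) := TopologicalSpace.denseRange_denseSeq H y
  have := map_mem_closure (t := (cyc M {ξ} : Set H)) p.continuous hden (by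
    rintro _ ⟨n, rfl⟩; exact hxW n)
  rwa [(cyc_closed M {ξ}).closure_eq] at this

theorem s7_units (M : VonNeumannAlgebra H) [TopologicalSpace.SeparableSpace H] [Nontrivial H]
    {m : ℕ} (hm : 0 < m)
    (φ : ↥M.commutant.toStarSubalgebra ≃⋆ₐ[ℂ] Matrix (Fin m) (Fin m) ↥M.toStarSubalgebra)
    (hcomm : ∀ a ∈ M, ∀ b ∈ M, a * b = b * a) :
    ∃ (F : Fin m → (H →L[ℂ] H)) (ξ : H), (∀ j, F j ∈ M.commutant) ∧
      ‖ξ‖ = 1 ∧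
      (∀ j k, j ≠ k → star (F j) * F k = 0) ∧
      (∀ j, (star (F j) * F j) ξ = ξ) ∧
      (∑ j, F j * star (F j) = 1) ∧
      (∀ j x, star (F j) x ∈ cyc M {ξ}) := by
  classical
  set i0 : Fin m := ⟨0, hm⟩ 
  set E : Fin m → Fin m → (H →L[ℂ] H) := fun i j => (φ.symm (Matrix.single i j 1) : ↥M.commutant.toStarSubalgebra) with hE
  have hEM : ∀ i j, E i j ∈ M.commutant := fun i j => (φ.symm (Matrix.single i j 1)).2
  have hEs : ∀ i j, star (E i j) = E j i := by
    intro i j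
    have h1 : star (φ.symm (Matrix.single i j 1)) = φ.symm (Matrix.single j i 1) := by
      rw [← map_star]
      congr 1
      rw [Matrix.star_eq_conjTranspose, Matrix.conjTranspose_single, star_one]
    exact congr(($h1 : H →L[ℂ] H))
  have hEE : ∀ i j k, E i j * E j k = E i k := by
    intro i j k
    have h1 : φ.symm (Matrix.single i j 1) * φ.symm (Matrix.single j k 1) = φ.symm (Matrix.single i k 1) := by
      rw [← map_mul]
      simp
    exact congr(($h1 : H →L[ℂ] H))
  have hEE0 : ∀ i j k l, j ≠ k → E i j * E k l = 0 := by
    intro i j k l hjk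
    have h1 : φ.symm (Matrix.single i j 1) * φ.symm (Matrix.single k l 1) = 0 := by
      rw [← map_mul]
      simp [hjk]
    exact congr(($h1 : H →L[ℂ] H))
  have hE1 : ∑ i, E i i = 1 := by
    have h1 : ∑ i, φ.symm (Matrix.single i i 1) = 1 := by
      rw [← map_sum, Matrix.sum_single_one, map_one]
    have := congr(($h1 : H →L[ℂ] H))
    simpa [hE] using this
  have hp : IsPr M.commutant (E i0 i0) := ⟨hEM _ _, hEE _ _ _, hEs _ _⟩
  have hab : ∀ x ∈ M.commutant, ∀ y ∈ M.commutant,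
      (E i0 i0 * x * E i0 i0) * (E i0 i0 * y * E i0 i0) = (E i0 i0 * y * E i0 i0) * (E i0 i0 * x * E i0 i0) := by
    intro x hx y hy
    set e := φ.symm (Matrix.single i0 i0 1)
    have h1 : (e * ⟨x, hx⟩ * e) * (e * ⟨y, hy⟩ * e) = (e * ⟨y, hy⟩ * e) * (e * ⟨x, hx⟩ * e) := by
      have hφe : φ e = Matrix.single i0 i0 1 := φ.apply_symm_apply _
      have key : ∀ z w : ↥M.commutant.toStarSubalgebra, φ ((e * z * e) * (e * w * e)) =
          Matrix.single i0 i0 (φ z i0 i0 * φ w i0 i0) := by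
        intro z w
        simp only [map_mul, hφe, Matrix.single_mul_mul_single, Matrix.single_mul_single_same,
          one_mul, mul_one]
      refine φ.injective ((key _ _).trans (Eq.trans ?_ (key _ _).symm))
      congr 1
      exact Subtype.ext (hcomm _ (Subtype.property _) _ (Subtype.property _))
    exact congr(($h1 : H →L[ℂ] H))
  obtain ⟨ξ, hξ, hcyc⟩ := s7_cyclic M hp hab
  have hmem : ∀ j x, E i0 j x ∈ cyc M {ξ} := by
    intro j x
    apply hcyc
    exact congr($(hEE i0 i0 j) x)
  have hξ0 : ξ ≠ 0 := by
    rintro rfl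
    have hz : cyc M {(0 : H)} ≤ ⊥ := by
      apply cyc_le M (by simp)
      rintro a _ _ rfl
      simp
    obtain ⟨x, hx⟩ := exists_ne (0 : H)
    apply hx
    have h1 : (∑ i, E i i) x = x := by rw [hE1]; rfl
    rw [← h1, sum_apply]
    apply Finset.sum_eq_zero
    intro i _
    rw [← hEE i i0 i, mul_apply_eq_comp, (Submodule.mem_bot ℂ).1 (hz (hmem i x)), map_zero]
  have hn : ‖ξ‖ ≠ 0 := norm_ne_zero_iff.2 hξ0
  refine ⟨fun j => E j i0, ((‖ξ‖⁻¹ : ℝ) : ℂ) • ξ, fun j => hEM _ _, ?_, ?_, ?_, ?_, ?_⟩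
  · rw [norm_smul, Complex.norm_real, norm_inv, norm_norm, inv_mul_cancel₀ hn]
  · intro j k hjk
    rw [hEs]; exact hEE0 _ _ _ _ hjk
  · intro j
    rw [hEs, hEE, map_smul, hξ]
  · simp only [hEs, hEE, hE1]
  · intro j x
    rw [hEs]
    have : cyc M {ξ} ≤ cyc M {((‖ξ‖⁻¹ : ℝ) : ℂ) • ξ} := by
      apply cyc_le M (cyc_closed _ _)
      intro a ha z hz
      rw [Set.mem_singleton_iff.1 hz]
      apply cyc_inv M ha
      have h1 : ξ = (‖ξ‖ : ℂ) • (((‖ξ‖⁻¹ : ℝ) : ℂ) • ξ) := by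
        rw [smul_smul, ← Complex.ofReal_mul, mul_inv_cancel₀ hn]; simp
      have h2 := Submodule.smul_mem _ (‖ξ‖ : ℂ) (cyc_subset M (Set.mem_singleton (((‖ξ‖⁻¹ : ℝ) : ℂ) • ξ)))
      rwa [← h1] at h2
    exact this (hmem j x)
end S7b

section S7c
variable {H : Type} [NormedAddCommGroup H] [InnerProductSpace ℂ H] [CompleteSpace H]

theorem IsPr.pyth {M : VonNeumannAlgebra H} {e : H →L[ℂ] H} (he : IsPr M e) (x : H) :
    ‖x‖ ^ 2 = ‖e x‖ ^ 2 + ‖x - e x‖ ^ 2 := by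
  have h0 : inner ℂ (e x) (x - e x) = 0 := by
    have h1 : inner ℂ (e x) (x - e x) = inner ℂ x (star e (x - e x)) := by
      rw [ContinuousLinearMap.star_eq_adjoint, ContinuousLinearMap.adjoint_inner_right]
    have h2 : e (e x) = e x := congr($(he.2.1) x)
    rw [h1, he.2.2, map_sub, h2, sub_self, inner_zero_right]
  have := norm_add_sq_eq_norm_sq_add_norm_sq_of_inner_eq_zero (𝕜 := ℂ) _ _ h0
  rw [add_sub_cancel] at this
  nlinarith

theorem IsPr.norm_le {M : VonNeumannAlgebra H} {e : H →L[ℂ] H} (he : IsPr M e) (x : H) :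
    ‖e x‖ ≤ ‖x‖ := by
  have := he.pyth x
  apply le_of_sq_le_sq _ (norm_nonneg _)
  nlinarith [sq_nonneg ‖x - e x‖]

theorem IsPr.diff {M : VonNeumannAlgebra H} {e f : H →L[ℂ] H} (he : IsPr M e) (hef : e * f = e)
    (x : H) : ‖f x‖ ^ 2 = ‖e x‖ ^ 2 + ‖f x - e x‖ ^ 2 := by
  have h1 : e (f x) = e x := congr($hef x)
  have := he.pyth (f x)
  rwa [h1] at this

theorem IsPr.compl {M : VonNeumannAlgebra H} {e : H →L[ℂ] H} (he : IsPr M e) : IsPr M (1 - e) := by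
  refine ⟨sub_mem (one_mem M) he.1, ?_, ?_⟩
  · simp [mul_sub, sub_mul, he.2.1]
  · simp [he.2.2]

theorem s7_sup (M : VonNeumannAlgebra H) (hcomm : ∀ a ∈ M, ∀ b ∈ M, a * b = b * a)
    (S : Set (H →L[ℂ] H)) (hS : ∀ e ∈ S, IsPr M e) (hne : S.Nonempty)
    (hch : ∀ c ∈ S, ∀ d ∈ S, c * d = c ∨ d * c = d) :
    ∃ s, IsPr M s ∧ (∀ e ∈ S, e * s = e) ∧
      (∀ f, IsPr M f → (∀ e ∈ S, e * f = e) → s * f = s) ∧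
      ∀ (ξ : H) (t : ℝ), (∀ e ∈ S, ‖e ξ‖ ^ 2 ≤ t) → ‖s ξ‖ ^ 2 ≤ t := by
  let K₀ : Submodule ℂ H :=
    { carrier := {x | ∃ e ∈ S, e x = x}
      zero_mem' := by
        obtain ⟨e, he⟩ := hne
        exact ⟨e, he, map_zero e⟩
      add_mem' := by
        have key : ∀ e ∈ S, ∀ f ∈ S, e * f = e → ∀ x, e x = x → f x = x := by
          intro e he f hf hef x hx
          rw [hcomm e (hS e he).1 f (hS f hf).1] at hef
          rw [← hx]
          exact congr($hef x)
        rintro x y ⟨e, he, hx⟩ ⟨f, hf, hy⟩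
        rcases hch e he f hf with h | h
        · exact ⟨f, hf, by rw [map_add, hy, key e he f hf h x hx]⟩
        · exact ⟨e, he, by rw [map_add, hx, key f hf e he h y hy]⟩
      smul_mem' := by
        rintro c x ⟨e, he, hx⟩
        exact ⟨e, he, by rw [map_smul, hx]⟩ }
  let K := K₀.topologicalClosure
  have hK : IsClosed (K : Set H) := Submodule.isClosed_topologicalClosure _
  have : CompleteSpace K := hK.completeSpace_coe
  have hPr : IsPr M K.starProjection := by
    apply s7_proj_mem
    intro y hy x hx
    refine map_mem_closure (t := (K₀ : Set H)) y.continuous hx ?_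
    rintro z ⟨e, he, hz⟩
    have hc := VonNeumannAlgebra.mem_commutant_iff.1 hy e (hS e he).1
    refine ⟨e, he, ?_⟩
    have : e (y z) = y (e z) := congr($hc z)
    rw [this, hz]
  have hes : ∀ e ∈ S, e * K.starProjection = e := by
    intro e he
    rw [hcomm e (hS e he).1 _ hPr.1]
    ext x
    refine Submodule.starProjection_eq_self_iff.2 (Submodule.le_topologicalClosure _ ⟨e, he, ?_⟩)
    exact congr($((hS e he).2.1) x)
  refine ⟨K.starProjection, hPr, hes, ?_, ?_⟩
  · intro f hf hef
    rw [hcomm _ hPr.1 _ hf.1]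
    have hle : K ≤ (LinearMap.eqLocus (f : H →ₗ[ℂ] H) LinearMap.id : Submodule ℂ H) := by
      apply Submodule.topologicalClosure_minimal
      · rintro x ⟨e, he, hx⟩
        have h1 := hef e he
        rw [hcomm e (hS e he).1 f hf.1] at h1
        change f x = x
        rw [← hx]
        exact congr($h1 x)
      · exact isClosed_eq f.continuous continuous_id
    ext x
    exact hle (Submodule.starProjection_apply_mem K x)
  · intro ξ t ht
    set s := K.starProjection
    have hmem : s ξ ∈ closure (K₀ : Set H) := Submodule.starProjection_apply_mem K ξ
    obtain ⟨y, hy, hlim⟩ := mem_closure_iff_seq_limit.1 hmem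
    choose e he hye using hy
    have hb : ∀ n, ‖e n ξ - s ξ‖ ≤ 2 * ‖y n - s ξ‖ := by
      intro n
      have h1 : e n ξ = e n (s ξ) := congr($((hes _ (he n)).symm) ξ)
      have h2 : e n ξ - s ξ = (y n - s ξ) - e n (y n - s ξ) := by
        rw [map_sub, hye, h1]; abel
      rw [h2]
      refine (norm_sub_le _ _).trans ?_
      have := (hS _ (he n)).norm_le (y n - s ξ)
      linarith
    have hl2 : Filter.Tendsto (fun n => e n ξ) Filter.atTop (nhds (s ξ)) := by
      rw [tendsto_iff_norm_sub_tendsto_zero] at hlim ⊢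
      refine squeeze_zero (fun _ => norm_nonneg _) hb ?_
      simpa using hlim.const_mul 2
    exact le_of_tendsto (hl2.norm.pow 2) (Filter.Eventually.of_forall fun n => ht _ (he n))

theorem s7_inf (M : VonNeumannAlgebra H) (hcomm : ∀ a ∈ M, ∀ b ∈ M, a * b = b * a)
    (S : Set (H →L[ℂ] H)) (hS : ∀ e ∈ S, IsPr M e) (hne : S.Nonempty)
    (hch : ∀ c ∈ S, ∀ d ∈ S, c * d = c ∨ d * c = d) :
    ∃ s, IsPr M s ∧ (∀ e ∈ S, s * e = s) ∧
      (∀ f, IsPr M f → (∀ e ∈ S, f * e = f) → f * s = f) ∧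
      ∀ (ξ : H) (t : ℝ), (∀ e ∈ S, t ≤ ‖e ξ‖ ^ 2) → t ≤ ‖s ξ‖ ^ 2 := by
  have hc : ∀ e f : H →L[ℂ] H, IsPr M e → IsPr M f → e * f = e → (1 - f) * (1 - e) = 1 - f := by
    intro e f he hf h
    rw [hcomm e he.1 f hf.1] at h
    simp [mul_sub, sub_mul, h]
  obtain ⟨s, hs, h1, h2, h3⟩ := s7_sup M hcomm ((fun e => 1 - e) '' S)
    (by rintro _ ⟨e, he, rfl⟩; exact (hS e he).compl) (hne.image _) (by
      rintro _ ⟨e, he, rfl⟩ _ ⟨f, hf, rfl⟩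
      rcases hch e he f hf with h | h
      · exact Or.inr (hc e f (hS e he) (hS f hf) h)
      · exact Or.inl (hc f e (hS f hf) (hS e he) h))
  refine ⟨1 - s, hs.compl, ?_, ?_, ?_⟩
  · intro e he
    have := hc _ _ (hS e he).compl hs (h1 _ ⟨e, he, rfl⟩)
    simpa using this
  · intro f hf hfe
    have := h2 (1 - f) hf.compl (by
      rintro _ ⟨e, he, rfl⟩
      exact hc f e hf (hS e he) (hfe e he))
    have := hc _ _ hs hf.compl this
    simpa using this
  · intro ξ t ht
    have h4 := h3 ξ (‖ξ‖ ^ 2 - t) (by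
      rintro _ ⟨e, he, rfl⟩
      have h5 := (hS e he).pyth ξ
      have h6 := ht e he
      have h7 : (1 - e) ξ = ξ - e ξ := rfl
      simp only [h7]
      linarith)
    have h5 := hs.pyth ξ
    have h7 : (1 - s) ξ = ξ - s ξ := rfl
    rw [h7]
    linarith

theorem s7_maxchain (M : VonNeumannAlgebra H)
    (C₀ : Set (H →L[ℂ] H)) (hS : ∀ e ∈ C₀, IsPr M e)
    (hch : ∀ c ∈ C₀, ∀ d ∈ C₀, c * d = c ∨ d * c = d) :
    ∃ C : Set (H →L[ℂ] H), C₀ ⊆ C ∧ (∀ e ∈ C, IsPr M e) ∧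
      (∀ c ∈ C, ∀ d ∈ C, c * d = c ∨ d * c = d) ∧
      ∀ x, IsPr M x → (∀ c ∈ C, c * x = c ∨ x * c = x) → x ∈ C := by
  obtain ⟨C, hC₀, hC⟩ := zorn_subset_nonempty
    {C : Set (H →L[ℂ] H) | (∀ e ∈ C, IsPr M e) ∧ ∀ c ∈ C, ∀ d ∈ C, c * d = c ∨ d * c = d}
    (by
      intro c hc hchain hne
      refine ⟨⋃₀ c, ⟨?_, ?_⟩, fun s hs => Set.subset_sUnion_of_mem hs⟩
      · rintro e ⟨s, hs, he⟩
        exact (hc hs).1 e he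
      · rintro e ⟨s, hs, he⟩ f ⟨t, ht, hf⟩
        rcases hchain.total hs ht with h | h
        · exact (hc ht).2 e (h he) f hf
        · exact (hc hs).2 e he f (h hf)) C₀ ⟨hS, hch⟩
  refine ⟨C, hC₀, hC.prop.1, hC.prop.2, ?_⟩
  intro x hx hxc
  have : insert x C ⊆ C := hC.le_of_ge ⟨?_, ?_⟩ (Set.subset_insert x C)
  · exact this (Set.mem_insert _ _)
  · rintro e (rfl | he)
    · exact hx
    · exact hC.prop.1 e he
  · rintro e (rfl | he) f (rfl | hf)
    · exact Or.inl hx.2.1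
    · exact (hxc f hf).symm
    · exact hxc e he
    · exact hC.prop.2 e he f hf

theorem s7_flow (M : VonNeumannAlgebra H) (hcomm : ∀ a ∈ M, ∀ b ∈ M, a * b = b * a)
    (hmin : HasNoMinimalProjection M) (ξ : H) (hξ : ‖ξ‖ = 1)
    (hsepv : ∀ a ∈ M, a ξ = 0 → a = 0)
    (C₀ : Set (H →L[ℂ] H)) (hS : ∀ e ∈ C₀, IsPr M e)
    (hch : ∀ c ∈ C₀, ∀ d ∈ C₀, c * d = c ∨ d * c = d) :
    ∃ e : unitInterval → (H →L[ℂ] H), (∀ t, IsPr M (e t)) ∧ (∀ s t, e s * e t = e (min s t)) ∧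
      (∀ t, ‖e t ξ‖ ^ 2 = t) ∧ C₀ ⊆ Set.range e := by
  obtain ⟨C, hC₀, hCP, hCC, hmax⟩ := s7_maxchain M C₀ hS hch
  have hmono : ∀ c d, IsPr M c → c * d = c → ‖c ξ‖ ^ 2 ≤ ‖d ξ‖ ^ 2 := by
    intro c d hc hcd
    have := hc.diff hcd ξ
    nlinarith [sq_nonneg ‖d ξ - c ξ‖]
  have hinj : ∀ c d, IsPr M c → IsPr M d → c * d = c → ‖d ξ‖ ^ 2 ≤ ‖c ξ‖ ^ 2 → c = d := by
    intro c d hc hd hcd h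
    have h1 := hc.diff hcd ξ
    have h2 : ‖d ξ - c ξ‖ ^ 2 = 0 := le_antisymm (by linarith) (sq_nonneg _)
    have h3 : (d - c) ξ = 0 := norm_eq_zero.1 (pow_eq_zero_iff two_ne_zero |>.1 h2)
    exact (sub_eq_zero.1 (hsepv _ (sub_mem hd.1 hc.1) h3)).symm
  have hP0 : IsPr M 0 := ⟨zero_mem M, by simp, by simp⟩
  have hP1 : IsPr M 1 := ⟨one_mem M, by simp, by simp⟩
  have h0C : (0 : H →L[ℂ] H) ∈ C := hmax 0 hP0 (fun c _ => Or.inr (by simp))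
  have h1C : (1 : H →L[ℂ] H) ∈ C := hmax 1 hP1 (fun c _ => Or.inl (by simp))
  have htrans : ∀ a b c : H →L[ℂ] H, a * b = a → b * c = b → a * c = a := by
    intro a b c hab hbc
    rw [← hab, mul_assoc, hbc]
  have hex : ∀ t : unitInterval, ∃ c ∈ C, ‖c ξ‖ ^ 2 = t := by
    rintro ⟨t, ht0, ht1⟩
    simp only
    obtain ⟨s, hs, hs1, hs2, hs3⟩ := s7_sup M hcomm {c ∈ C | ‖c ξ‖ ^ 2 ≤ t}
      (fun e he => hCP e he.1) ⟨0, h0C, by simpa using ht0⟩ (fun c hc d hd => hCC c hc.1 d hd.1)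
    obtain ⟨u, hu, hu1, hu2, hu3⟩ := s7_inf M hcomm {c ∈ C | t < ‖c ξ‖ ^ 2 ∨ c = 1}
      (fun e he => hCP e he.1) ⟨1, h1C, Or.inr rfl⟩ (fun c hc d hd => hCC c hc.1 d hd.1)
    have hst : ‖s ξ‖ ^ 2 ≤ t := hs3 ξ t (fun e he => he.2)
    have hut : t ≤ ‖u ξ‖ ^ 2 := hu3 ξ t (by
      rintro e ⟨he, h | rfl⟩
      · exact h.le
      · simpa [hξ] using ht1)
    have hLR : ∀ c ∈ C, ∀ d ∈ C, ‖c ξ‖ ^ 2 ≤ t → t < ‖d ξ‖ ^ 2 ∨ d = 1 → c * d = c := by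
      rintro c hc d hd hct (hdt | rfl)
      · rcases hCC c hc d hd with h | h
        · exact h
        · have := hmono d c (hCP d hd) h
          linarith
      · simp
    have hsC : s ∈ C := by
      apply hmax s hs
      intro c hc
      by_cases h : ‖c ξ‖ ^ 2 ≤ t
      · exact Or.inl (hs1 c ⟨hc, h⟩)
      · exact Or.inr (hs2 c (hCP c hc) (fun e he => hLR e he.1 c hc he.2 (Or.inl (not_le.1 h))))
    have huC : u ∈ C := by
      apply hmax u hu
      intro c hc
      by_cases h : ‖c ξ‖ ^ 2 ≤ t
      · exact Or.inl (hu2 c (hCP c hc) (fun e he => hLR c hc e he.1 h he.2))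
      · exact Or.inr (hu1 c ⟨hc, Or.inl (not_le.1 h)⟩)
    by_cases hse : ‖s ξ‖ ^ 2 = t
    · exact ⟨s, hsC, hse⟩
    exfalso
    have hsu : s * u = s := by
      rcases hCC s hsC u huC with h | h
      · exact h
      · have := hmono u s hu h
        exact absurd (by linarith) hse
    have hus : u * s = s := by rw [hcomm u hu.1 s hs.1, hsu]
    have hne : u - s ≠ 0 := by
      intro h
      rw [sub_eq_zero] at h
      subst h
      exact hse (le_antisymm hst hut)
    apply hmin
    refine ⟨u - s, sub_mem hu.1 hs.1, hne, ?_, ?_, ?_⟩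
    · simp [IsIdempotentElem, mul_sub, sub_mul, hu.2.1, hs.2.1, hsu, hus]
    · simp [IsSelfAdjoint, hu.2.2, hs.2.2]
    intro q hq hqi hqs hqp
    have hqq : q * q = q := hqi
    have hqsx : q * s = 0 := by
      rw [← hqp, mul_assoc, sub_mul, hus, hs.2.1, sub_self, mul_zero]
    have hsq : s * q = 0 := by rw [hcomm s hs.1 q hq, hqsx]
    have hqu : q * u = q := by
      have h := hqp
      rw [mul_sub, hqsx, sub_zero] at h
      exact h
    have huq : u * q = q := by rw [hcomm u hu.1 q hq, hqu]
    have hw : IsPr M (s + q) := by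
      refine ⟨add_mem hs.1 hq, ?_, ?_⟩
      · simp [mul_add, add_mul, hs.2.1, hqq, hqsx, hsq]
      · rw [star_add, hs.2.2, hqs.star_eq]
    have hsw : s * (s + q) = s := by rw [mul_add, hs.2.1, hsq, add_zero]
    have hwu : (s + q) * u = s + q := by rw [add_mul, hsu, hqu]
    have hwC : s + q ∈ C := by
      apply hmax _ hw
      intro c hc
      by_cases h : ‖c ξ‖ ^ 2 ≤ t
      · exact Or.inl (htrans _ _ _ (hs1 c ⟨hc, h⟩) hsw)
      · exact Or.inr (htrans _ _ _ hwu (hu1 c ⟨hc, Or.inl (not_le.1 h)⟩))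
    by_cases h : ‖(s + q) ξ‖ ^ 2 ≤ t
    · left
      have := hs1 _ ⟨hwC, h⟩
      rw [add_mul, hs.2.1, hqsx, add_zero] at this
      simpa using this.symm
    · right
      have := hu1 _ ⟨hwC, Or.inl (not_le.1 h)⟩
      rw [mul_add, hus, huq] at this
      rw [← this]; abel
  choose e heC heμ using hex
  have heP : ∀ t, IsPr M (e t) := fun t => hCP _ (heC t)
  have hle : ∀ s t : unitInterval, s ≤ t → e s * e t = e s := by
    intro s t hst
    rcases hCC _ (heC s) _ (heC t) with h | h
    · exact h
    · have := hinj _ _ (heP t) (heP s) h (by rw [heμ, heμ]; exact hst)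
      rw [this]; exact (heP s).2.1
  refine ⟨e, heP, ?_, heμ, ?_⟩
  · intro s t
    rcases le_total s t with h | h
    · rw [min_eq_left h, hle s t h]
    · rw [min_eq_right h, hcomm _ (heP s).1 _ (heP t).1, hle t s h]
  · intro c hc
    have hcC := hC₀ hc
    have hcP := hCP c hcC
    have h1 : ‖c ξ‖ ^ 2 ≤ 1 := by
      have := hmono c 1 hcP (by simp)
      simpa [hξ] using this
    refine ⟨⟨‖c ξ‖ ^ 2, sq_nonneg _, h1⟩, ?_⟩
    set t : unitInterval := ⟨‖c ξ‖ ^ 2, sq_nonneg _, h1⟩ with ht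
    have h2 : ‖e t ξ‖ ^ 2 = ‖c ξ‖ ^ 2 := heμ t
    rcases hCC _ (heC t) c hcC with h | h
    · exact hinj _ _ (heP t) hcP h h2.ge
    · exact (hinj _ _ hcP (heP t) h h2.le).symm

/-- refinement of a chain -/
def s7ref (f : H →L[ℂ] H) (g : ℕ → (H →L[ℂ] H)) (k : ℕ) : H →L[ℂ] H :=
  if k % 2 = 0 then g (k / 2) else g (k / 2) + f * (g (k / 2 + 1) - g (k / 2))

/-- good chains -/
def s7good (M : VonNeumannAlgebra H) (g : ℕ → (H →L[ℂ] H)) : Prop :=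
  (∀ k, IsPr M (g k)) ∧ (∀ k, g k * g (k+1) = g k) ∧ g 0 = 0 ∧ ∃ K, ∀ k ≥ K, g k = 1

theorem s7ref_even (f : H →L[ℂ] H) (g : ℕ → (H →L[ℂ] H)) (k : ℕ) : s7ref f g (2 * k) = g k := by
  simp [s7ref]

theorem s7ref_odd (f : H →L[ℂ] H) (g : ℕ → (H →L[ℂ] H)) (k : ℕ) :
    s7ref f g (2 * k + 1) = g k + f * (g (k+1) - g k) := by
  have h1 : (2 * k + 1) / 2 = k := by omega
  have h2 : (2 * k + 1) % 2 = 1 := by omega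
  simp [s7ref, h1, h2]

theorem s7ref_good {M : VonNeumannAlgebra H} (hcomm : ∀ a ∈ M, ∀ b ∈ M, a * b = b * a)
    {f : H →L[ℂ] H} (hf : IsPr M f) {g : ℕ → (H →L[ℂ] H)} (hg : s7good M g) :
    s7good M (s7ref f g) := by
  obtain ⟨h1, h2, h3, K, hK⟩ := hg
  have h2' : ∀ k, g (k+1) * g k = g k := fun k => by rw [hcomm _ (h1 _).1 _ (h1 _).1, h2]
  -- q k = f * (g (k+1) - g k)
  have hqM : ∀ k, f * (g (k+1) - g k) ∈ M := fun k => mul_mem hf.1 (sub_mem (h1 _).1 (h1 _).1)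
  have hdM : ∀ k, g (k+1) - g k ∈ M := fun k => sub_mem (h1 _).1 (h1 _).1
  have hdd : ∀ k, (g (k+1) - g k) * (g (k+1) - g k) = g (k+1) - g k := by
    intro k
    simp [mul_sub, sub_mul, (h1 _).2.1, h2, h2']
  have hqg : ∀ k, f * (g (k+1) - g k) * g k = 0 := by
    intro k
    rw [mul_assoc, sub_mul, h2', (h1 k).2.1, sub_self, mul_zero]
  have hgq : ∀ k, g k * (f * (g (k+1) - g k)) = 0 := by
    intro k
    rw [hcomm _ (h1 k).1 _ (hqM k), hqg]
  have hqq : ∀ k, f * (g (k+1) - g k) * (f * (g (k+1) - g k)) = f * (g (k+1) - g k) := by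
    intro k
    rw [mul_assoc, ← mul_assoc _ f, hcomm _ (hdM k) f hf.1, mul_assoc f, hdd, ← mul_assoc, hf.2.1]
  have hqg1 : ∀ k, f * (g (k+1) - g k) * g (k+1) = f * (g (k+1) - g k) := by
    intro k
    rw [mul_assoc, sub_mul, h2, (h1 _).2.1]
  have hqs : ∀ k, star (f * (g (k+1) - g k)) = f * (g (k+1) - g k) := by
    intro k
    rw [star_mul, hf.2.2, star_sub, (h1 _).2.2, (h1 _).2.2, hcomm _ (hdM k) f hf.1]
  refine ⟨?_, ?_, ?_, 2 * K, ?_⟩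
  · intro k
    rcases Nat.even_or_odd' k with ⟨j, rfl | rfl⟩
    · rw [s7ref_even]; exact h1 j
    · rw [s7ref_odd]
      refine ⟨add_mem (h1 j).1 (hqM j), ?_, ?_⟩
      · rw [add_mul, mul_add, mul_add, hqg, hgq, hqq, (h1 j).2.1]; simp
      · rw [star_add, hqs, (h1 j).2.2]
  · intro k
    rcases Nat.even_or_odd' k with ⟨j, rfl | rfl⟩
    · rw [s7ref_even, s7ref_odd, mul_add, hgq, (h1 j).2.1, add_zero]
    · rw [show 2 * j + 1 + 1 = 2 * (j + 1) by ring, s7ref_even, s7ref_odd, add_mul, hqg1, h2]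
  · rw [show 0 = 2 * 0 by rfl, s7ref_even, h3]
  · intro k hk
    rcases Nat.even_or_odd' k with ⟨j, rfl | rfl⟩
    · rw [s7ref_even]; exact hK j (by omega)
    · rw [s7ref_odd, hK j (by omega), hK (j+1) (by omega)]; simp

theorem s7ref_span {M : VonNeumannAlgebra H} (f : H →L[ℂ] H) {g : ℕ → (H →L[ℂ] H)}
    (hg : s7good M g) : f ∈ Submodule.span ℂ (Set.range (s7ref f g)) := by
  obtain ⟨h1, h2, h3, K, hK⟩ := hg
  have : f = ∑ k ∈ Finset.range K, (s7ref f g (2 * k + 1) - s7ref f g (2 * k)) := by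
    have h4 : ∀ k, s7ref f g (2 * k + 1) - s7ref f g (2 * k) = f * g (k+1) - f * g k := by
      intro k
      rw [s7ref_odd, s7ref_even, mul_sub]; abel
    simp only [h4]
    rw [Finset.sum_range_sub (fun k => f * g k), hK K le_rfl, h3]
    simp
  refine (congrArg (fun z => z ∈ Submodule.span ℂ (Set.range (s7ref f g))) this).mpr ?_
  exact Submodule.sum_mem _ fun k _ =>
    sub_mem (Submodule.subset_span ⟨_, rfl⟩) (Submodule.subset_span ⟨_, rfl⟩)

theorem s7good_mono {M : VonNeumannAlgebra H} {g : ℕ → (H →L[ℂ] H)}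
    (hg : s7good M g) {i j : ℕ} (hij : i ≤ j) : g i * g j = g i := by
  induction j, hij using Nat.le_induction with
  | base => exact (hg.1 i).2.1
  | succ j _ ih => rw [← ih, mul_assoc, hg.2.1 j]

theorem s7_chain (M : VonNeumannAlgebra H) (hcomm : ∀ a ∈ M, ∀ b ∈ M, a * b = b * a)
    (f : ℕ → (H →L[ℂ] H)) (hf : ∀ n, IsPr M (f n)) :
    ∃ C : Set (H →L[ℂ] H), (∀ e ∈ C, IsPr M e) ∧
      (∀ c ∈ C, ∀ d ∈ C, c * d = c ∨ d * c = d) ∧ ∀ n, f n ∈ Submodule.span ℂ C := by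
  let G : ℕ → ℕ → (H →L[ℂ] H) := fun n =>
    Nat.rec (fun k => if k = 0 then 0 else 1) (fun n g => s7ref (f n) g) n
  have hG0 : G 0 = fun k => if k = 0 then 0 else 1 := rfl
  have hGs : ∀ n, G (n+1) = s7ref (f n) (G n) := fun n => rfl
  have hgood : ∀ n, s7good M (G n) := by
    intro n
    induction n with
    | zero =>
      rw [hG0]
      refine ⟨?_, ?_, by simp, 1, ?_⟩
      · intro k
        by_cases hk : k = 0
        · simp only [hk, if_true]; exact ⟨zero_mem M, by simp, by simp⟩
        · simp only [hk, if_false]; exact ⟨one_mem M, by simp, by simp⟩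
      · intro k; simp
      · intro k hk
        simp [show k ≠ 0 by omega]
    | succ n ih => rw [hGs]; exact s7ref_good hcomm (hf n) ih
  have hsub : Monotone (fun n => Set.range (G n)) := by
    apply monotone_nat_of_le_succ
    rintro n _ ⟨k, rfl⟩
    exact ⟨2 * k, by rw [hGs, s7ref_even]⟩
  refine ⟨⋃ n, Set.range (G n), ?_, ?_, ?_⟩
  · intro e he
    obtain ⟨n, k, rfl⟩ := Set.mem_iUnion.1 he
    exact (hgood n).1 k
  · intro c hc d hd
    obtain ⟨n, hc⟩ := Set.mem_iUnion.1 hc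
    obtain ⟨n', hd⟩ := Set.mem_iUnion.1 hd
    obtain ⟨i, rfl⟩ := hsub (le_max_left n n') hc
    obtain ⟨j, rfl⟩ := hsub (le_max_right n n') hd
    rcases le_total i j with h | h
    · exact Or.inl (s7good_mono (hgood _) h)
    · exact Or.inr (s7good_mono (hgood _) h)
  · intro n
    have h1 := s7ref_span (f n) (hgood n)
    rw [← hGs] at h1
    exact Submodule.span_mono (Set.subset_iUnion (fun n => Set.range (G n)) (n+1)) h1

end S7c

section S7d

theorem s7_struct {H : Type} [NormedAddCommGroup H] [InnerProductSpace ℂ H] [CompleteSpace H]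
    (M : VonNeumannAlgebra H) [TopologicalSpace.SeparableSpace H] [Nontrivial H]
    {m : ℕ} (hm : 0 < m)
    (φ : ↥M.commutant.toStarSubalgebra ≃⋆ₐ[ℂ] Matrix (Fin m) (Fin m) ↥M.toStarSubalgebra)
    (hcomm : ∀ a ∈ M, ∀ b ∈ M, a * b = b * a)
    (hmin : HasNoMinimalProjection M) :
    ∃ (e : unitInterval → (H →L[ℂ] H)) (v : Fin m → H),
      (∀ s t, e s * e t = e (min s t)) ∧
      (∀ s t j k, inner ℂ (e s (v j)) (e t (v k)) =
        if j = k then (((min s t : unitInterval) : ℝ) : ℂ) else 0) ∧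
      (Submodule.span ℂ (Set.range fun i : unitInterval × Fin m => e i.1 (v i.2))).topologicalClosure
        = ⊤ ∧
      ∀ T, T ∈ M ↔ ∀ S : H →L[ℂ] H, (∀ t, S * e t = e t * S) → S * T = T * S := by
  obtain ⟨F, ξ, hF, hξ, hF0, hF1, hFs, hcyc⟩ := s7_units M hm φ hcomm
  have hFc : ∀ j, ∀ a ∈ M, ∀ x, a (F j x) = F j (a x) := fun j a ha x =>
    congr($(VonNeumannAlgebra.mem_commutant_iff.1 (hF j) a ha) x)
  have hFsc : ∀ j, ∀ a ∈ M, ∀ x, a (star (F j) x) = star (F j) (a x) := fun j a ha x =>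
    congr($(VonNeumannAlgebra.mem_commutant_iff.1 (star_mem (hF j)) a ha) x)
  have hdec : ∀ x, ∑ j, F j (star (F j) x) = x := by
    intro x
    have := congr($hFs x)
    rw [sum_apply] at this
    exact this
  have hsepv : ∀ a ∈ M, a ξ = 0 → a = 0 := by
    intro a ha haξ
    have hk : cyc M {ξ} ≤ LinearMap.ker (a : H →ₗ[ℂ] H) := by
      apply cyc_le M a.isClosed_ker
      intro b hb x hx
      rw [Set.mem_singleton_iff.1 hx]
      have : a (b ξ) = b (a ξ) := congr($(hcomm a ha b hb) ξ)
      change a (b ξ) = 0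
      rw [this, haξ, map_zero]
    ext x
    rw [← hdec x, map_sum]
    refine (Finset.sum_eq_zero fun j _ => ?_).trans (by simp)
    have : a (star (F j) x) = 0 := hk (hcyc j x)
    rw [hFc j a ha, this, map_zero]
  -- a dense sequence among the vectors `e ξ`
  set s : Set H := {x | ∃ e, IsPr M e ∧ e ξ = x} with hs
  obtain ⟨c, hcs, hcc, hsc⟩ :=
    (TopologicalSpace.IsSeparable.of_separableSpace s).exists_countable_dense_subset
  have hcne : c.Nonempty := by
    by_contra hne
    rw [Set.not_nonempty_iff_eq_empty] at hne
    rw [hne, closure_empty] at hsc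
    exact hsc (⟨0, ⟨zero_mem M, by simp, by simp⟩, rfl⟩ : (0 : H →L[ℂ] H) ξ ∈ s)
  obtain ⟨y, rfl⟩ := hcc.exists_eq_range hcne
  have hy : ∀ n, ∃ e, IsPr M e ∧ e ξ = y n := fun n => hcs ⟨n, rfl⟩
  choose f hf hfy using hy
  obtain ⟨C₀, hC1, hC2, hC3⟩ := s7_chain M hcomm f hf
  obtain ⟨e, heP, hemul, heμ, heC⟩ := s7_flow M hcomm hmin ξ hξ hsepv C₀ hC1 hC2
  set W : Submodule ℂ H := (Submodule.span ℂ (Set.range fun t => e t ξ)).topologicalClosure with hW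
  have hWc : IsClosed (W : Set H) := Submodule.isClosed_topologicalClosure _
  have hyW : ∀ n, y n ∈ W := by
    intro n
    rw [← hfy]
    apply Submodule.le_topologicalClosure
    have : Submodule.span ℂ C₀ ≤ (Submodule.span ℂ (Set.range fun t => e t ξ)).comap
        ((ContinuousLinearMap.apply ℂ H ξ : (H →L[ℂ] H) →L[ℂ] H) : (H →L[ℂ] H) →ₗ[ℂ] H) := by
      rw [Submodule.span_le]
      intro d hd
      obtain ⟨t, rfl⟩ := heC hd
      exact Submodule.subset_span ⟨t, rfl⟩
    exact this (hC3 n)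
  have hsW : s ⊆ W := hsc.trans (closure_minimal (by rintro _ ⟨n, rfl⟩; exact hyW n) hWc)
  have haW : ∀ a ∈ M, a ξ ∈ W := by
    intro a ha
    have : (Submodule.span ℂ {e | IsPr M e}).topologicalClosure ≤ W.comap
        ((ContinuousLinearMap.apply ℂ H ξ : (H →L[ℂ] H) →L[ℂ] H) : (H →L[ℂ] H) →ₗ[ℂ] H) := by
      apply Submodule.topologicalClosure_minimal
      · rw [Submodule.span_le]
        intro d hd
        exact hsW ⟨d, hd, rfl⟩
      · exact hWc.preimage (ContinuousLinearMap.apply ℂ H ξ : (H →L[ℂ] H) →L[ℂ] H).continuous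
    exact this (s7_span_dense M ha)
  have hcW : cyc M {ξ} ≤ W := by
    apply cyc_le M hWc
    intro a ha x hx
    rw [Set.mem_singleton_iff.1 hx]
    exact haW a ha
  set V : Submodule ℂ H := Submodule.span ℂ
    (Set.range fun i : unitInterval × Fin m => e i.1 (F i.2 ξ)) with hV
  have htot : V.topologicalClosure = ⊤ := by
    rw [eq_top_iff]
    intro x _
    rw [← hdec x]
    refine Submodule.sum_mem _ fun j _ => ?_
    have : W ≤ V.topologicalClosure.comap (F j : H →ₗ[ℂ] H) := by
      apply Submodule.topologicalClosure_minimal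
      · rw [Submodule.span_le]
        rintro _ ⟨t, rfl⟩
        refine Submodule.le_topologicalClosure _ (Submodule.subset_span ⟨(t, j), ?_⟩)
        exact hFc j _ (heP t).1 ξ
      · exact (Submodule.isClosed_topologicalClosure V).preimage (F j).continuous
    exact this (hcW (hcyc j x))
  refine ⟨e, fun j => F j ξ, hemul, ?_, htot, ?_⟩
  · intro s t j k
    rw [hFc j _ (heP s).1, hFc k _ (heP t).1]
    have h1 : inner ℂ (F j (e s ξ)) (F k (e t ξ)) = inner ℂ (e s ξ) ((star (F j) * F k) (e t ξ)) := by
      rw [ContinuousLinearMap.star_eq_adjoint, mul_apply_eq_comp,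
        ContinuousLinearMap.adjoint_inner_right]
    rw [h1]
    split_ifs with hjk
    · subst hjk
      have h2 : (star (F j) * F j) (e t ξ) = e t ξ := by
        have h3 := hF1 j
        rw [mul_apply_eq_comp] at h3 ⊢
        rw [← hFc j _ (heP t).1, ← hFsc j _ (heP t).1, h3]
      rw [h2]
      have hadj : ∀ u x z, inner ℂ (e u x) z = inner ℂ x (e u z) := by
        intro u x z
        conv_rhs => rw [← (heP u).2.2]
        rw [ContinuousLinearMap.star_eq_adjoint, ContinuousLinearMap.adjoint_inner_right]
      have h4 : e s (e t ξ) = e (min s t) ξ := congr($(hemul s t) ξ)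
      have h5 : e (min s t) ξ = e (min s t) (e (min s t) ξ) :=
        congr($((heP (min s t)).2.1.symm) ξ)
      rw [hadj, h4, h5, ← hadj, inner_self_eq_norm_sq_to_K, ← heμ (min s t)]
      simp
    · rw [hF0 j k hjk]; simp
  · intro T
    constructor
    · intro hT S hS
      -- approximate
      obtain ⟨z, hz, hlim⟩ := mem_closure_iff_seq_limit.1
        (show T ξ ∈ closure ((Submodule.span ℂ (Set.range fun t => e t ξ) : Submodule ℂ H) : Set H) from haW T hT)
      have hz' : ∀ n, ∃ b ∈ Submodule.span ℂ (Set.range e), b ξ = z n := by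
        intro n
        have h1 : Submodule.span ℂ (Set.range fun t => e t ξ) ≤ (Submodule.span ℂ (Set.range e)).map
          ((ContinuousLinearMap.apply ℂ H ξ : (H →L[ℂ] H) →L[ℂ] H) : (H →L[ℂ] H) →ₗ[ℂ] H) := by
          rw [Submodule.span_le]
          rintro _ ⟨t, rfl⟩
          exact ⟨e t, Submodule.subset_span ⟨t, rfl⟩, rfl⟩
        exact h1 (hz n)
      choose b hb hbz using hz'
      have hbM : ∀ n, b n ∈ M := by
        intro n
        have h1 : Submodule.span ℂ (Set.range e) ≤ Subalgebra.toSubmodule M.toStarSubalgebra.toSubalgebra := by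
          rw [Submodule.span_le]
          rintro _ ⟨t, rfl⟩
          exact (heP t).1
        exact h1 (hb n)
      have hbS : ∀ n, S * b n = b n * S := by
        intro n
        have h1 : Submodule.span ℂ (Set.range e) ≤ Subalgebra.toSubmodule (Subalgebra.centralizer ℂ {S}) := by
          rw [Submodule.span_le]
          rintro _ ⟨t, rfl⟩
          rintro _ rfl
          exact hS t
        exact h1 (hb n) S rfl
      have hbv : ∀ t j, Filter.Tendsto (fun n => b n (e t (F j ξ))) Filter.atTop (nhds (T (e t (F j ξ)))) := by
        intro t j
        have h1 : ∀ a ∈ M, a (e t (F j ξ)) = e t (F j (a ξ)) := by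
          intro a ha
          have h2 : a (e t (F j ξ)) = e t (a (F j ξ)) := congr($(hcomm a ha _ (heP t).1) (F j ξ))
          rw [h2, hFc j a ha]
        rw [h1 T hT]
        simp only [fun n => h1 (b n) (hbM n), hbz]
        exact (((e t).continuous.comp (F j).continuous).tendsto _).comp hlim
      have hbvs : ∀ t j, Filter.Tendsto (fun n => star (b n) (e t (F j ξ))) Filter.atTop
          (nhds (star T (e t (F j ξ)))) := by
        intro t j
        have h1 := hbv t j
        rw [tendsto_iff_norm_sub_tendsto_zero] at h1 ⊢
        refine h1.congr fun n => ?_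
        have h2 : ∀ a ∈ M, ∀ x, ‖star a x‖ = ‖a x‖ := by
          intro a ha x
          have h3 : IsStarNormal a := ⟨hcomm _ (star_mem ha) _ ha⟩
          rw [ContinuousLinearMap.star_eq_adjoint]
          exact (ContinuousLinearMap.isStarNormal_iff_norm_eq_adjoint.mp h3 x).symm
        have h4 := h2 (b n - T) (sub_mem (hbM n) hT) (e t (F j ξ))
        rw [star_sub] at h4
        exact h4.symm
      have hinner : ∀ i k : unitInterval × Fin m,
          inner ℂ ((T * S) (e i.1 (F i.2 ξ))) (e k.1 (F k.2 ξ)) =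
          inner ℂ ((S * T) (e i.1 (F i.2 ξ))) (e k.1 (F k.2 ξ)) := by
        intro i k
        have ha : Filter.Tendsto (fun n => inner ℂ (S (e i.1 (F i.2 ξ))) (star (b n) (e k.1 (F k.2 ξ))))
            Filter.atTop (nhds (inner ℂ (S (e i.1 (F i.2 ξ))) (star T (e k.1 (F k.2 ξ))))) :=
          tendsto_const_nhds.inner (hbvs k.1 k.2)
        have hb' : Filter.Tendsto (fun n => inner ℂ (S (b n (e i.1 (F i.2 ξ)))) (e k.1 (F k.2 ξ)))
            Filter.atTop (nhds (inner ℂ (S (T (e i.1 (F i.2 ξ)))) (e k.1 (F k.2 ξ)))) :=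
          ((S.continuous.tendsto _).comp (hbv i.1 i.2)).inner tendsto_const_nhds
        have hadj : ∀ (A : H →L[ℂ] H) x z, inner ℂ x (star A z) = inner ℂ (A x) z := by
          intro A x z
          rw [ContinuousLinearMap.star_eq_adjoint, ContinuousLinearMap.adjoint_inner_right]
        have hEq : ∀ n, inner ℂ (S (e i.1 (F i.2 ξ))) (star (b n) (e k.1 (F k.2 ξ))) =
            inner ℂ (S (b n (e i.1 (F i.2 ξ)))) (e k.1 (F k.2 ξ)) := by
          intro n
          rw [hadj]
          congr 1
          exact congr($((hbS n).symm) _)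
        simp only [hEq] at ha
        have := tendsto_nhds_unique ha hb'
        rw [hadj] at this
        exact this
      have hd : Dense (V : Set H) := Submodule.dense_iff_topologicalClosure_eq_top.2 htot
      symm
      refine ContinuousLinearMap.ext_on hd ?_
      rintro _ ⟨i, rfl⟩
      refine hd.eq_of_inner_left (𝕜 := ℂ) ?_
      intro w hw
      induction hw using Submodule.span_induction with
      | mem x hx => obtain ⟨k, rfl⟩ := hx; exact hinner i k
      | zero => simp
      | add x y _ _ hx hy => rw [inner_add_right, inner_add_right, hx, hy]
      | smul a x _ hx => rw [inner_smul_right, inner_smul_right, hx]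
    · intro h
      apply s7_mem_of_comm
      intro y hy
      exact h y fun t => (VonNeumannAlgebra.mem_commutant_iff.1 hy _ (heP t).1).symm

theorem s7_unitary {ι H₁ H₂ : Type}
    [NormedAddCommGroup H₁] [InnerProductSpace ℂ H₁] [CompleteSpace H₁]
    [NormedAddCommGroup H₂] [InnerProductSpace ℂ H₂] [CompleteSpace H₂]
    (v : ι → H₁) (w : ι → H₂) (hv : (Submodule.span ℂ (Set.range v)).topologicalClosure = ⊤)
    (hw : (Submodule.span ℂ (Set.range w)).topologicalClosure = ⊤)
    (hvw : ∀ i j, inner ℂ (v i) (v j) = inner ℂ (w i) (w j)) :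
    ∃ U : H₁ ≃ₗᵢ[ℂ] H₂, ∀ i, U (v i) = w i := by
  have hd1 : DenseRange (Finsupp.linearCombination ℂ v) := by
    have := Submodule.dense_iff_topologicalClosure_eq_top.2 hv
    rwa [← Finsupp.range_linearCombination, LinearMap.coe_range] at this
  have hd2 : DenseRange (Finsupp.linearCombination ℂ w) := by
    have := Submodule.dense_iff_topologicalClosure_eq_top.2 hw
    rwa [← Finsupp.range_linearCombination, LinearMap.coe_range] at this
  have hn : ∀ x, ‖Finsupp.linearCombination ℂ w (LinearEquiv.refl ℂ (ι →₀ ℂ) x)‖ =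
      ‖Finsupp.linearCombination ℂ v x‖ := by
    intro x
    have h1 : inner ℂ (Finsupp.linearCombination ℂ w x) (Finsupp.linearCombination ℂ w x) =
        inner ℂ (Finsupp.linearCombination ℂ v x) (Finsupp.linearCombination ℂ v x) := by
      simp only [Finsupp.linearCombination_apply, Finsupp.sum_inner, Finsupp.inner_sum, inner_smul_left, inner_smul_right, hvw]
    rw [LinearEquiv.refl_apply, norm_eq_sqrt_re_inner (𝕜 := ℂ), norm_eq_sqrt_re_inner (𝕜 := ℂ), h1]
  refine ⟨(LinearEquiv.refl ℂ (ι →₀ ℂ)).extendOfIsometry _ _ hd1 hd2 hn, fun i => ?_⟩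
  have := LinearEquiv.extendOfIsometry_eq (LinearEquiv.refl ℂ (ι →₀ ℂ)) _ _ hd1 hd2 hn
    (Finsupp.single i 1)
  simpa using this

end S7d


/-- **Theorem 3.1 (von Neumann).** Up to unitary equivalence there is only one
commutative von Neumann algebra acting on an infinite-dimensional separable complex
Hilbert space with no minimal projection and multiplicity `m` (i.e. commutant
`*`-isomorphic to `m × m` matrices over itself). -/
theorem stmt7 {m : ℕ} (hm : 0 < m) {H₁ H₂ : Type}
    [NormedAddCommGroup H₁] [InnerProductSpace ℂ H₁] [CompleteSpace H₁]
    [NormedAddCommGroup H₂] [InnerProductSpace ℂ H₂] [CompleteSpace H₂]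
    (hsep₁ : TopologicalSpace.SeparableSpace H₁) (hsep₂ : TopologicalSpace.SeparableSpace H₂)
    (hinf₁ : ¬ FiniteDimensional ℂ H₁) (hinf₂ : ¬ FiniteDimensional ℂ H₂)
    (M₁ : VonNeumannAlgebra H₁) (M₂ : VonNeumannAlgebra H₂)
    (hcomm₁ : ∀ a ∈ M₁, ∀ b ∈ M₁, a * b = b * a)
    (hcomm₂ : ∀ a ∈ M₂, ∀ b ∈ M₂, a * b = b * a)
    (hmin₁ : HasNoMinimalProjection M₁) (hmin₂ : HasNoMinimalProjection M₂)
    (hmult₁ : Nonempty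
      (↥M₁.commutant.toStarSubalgebra ≃⋆ₐ[ℂ] Matrix (Fin m) (Fin m) ↥M₁.toStarSubalgebra))
    (hmult₂ : Nonempty
      (↥M₂.commutant.toStarSubalgebra ≃⋆ₐ[ℂ] Matrix (Fin m) (Fin m) ↥M₂.toStarSubalgebra)) :
    ∃ U : H₁ ≃ₗᵢ[ℂ] H₂, ∀ T : H₁ →L[ℂ] H₁,
      T ∈ M₁ ↔ (U.toLinearIsometry.toContinuousLinearMap ∘L T ∘L
        U.symm.toLinearIsometry.toContinuousLinearMap) ∈ M₂ := by
  have hn1 : Nontrivial H₁ := by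
    by_contra h
    rw [not_nontrivial_iff_subsingleton] at h
    exact hinf₁ inferInstance
  have hn2 : Nontrivial H₂ := by
    by_contra h
    rw [not_nontrivial_iff_subsingleton] at h
    exact hinf₂ inferInstance
  obtain ⟨φ₁⟩ := hmult₁
  obtain ⟨φ₂⟩ := hmult₂
  obtain ⟨e, v, he, hv, htv, hM1⟩ := s7_struct M₁ hm φ₁ hcomm₁ hmin₁
  obtain ⟨f, w, hf, hw, htw, hM2⟩ := s7_struct M₂ hm φ₂ hcomm₂ hmin₂
  obtain ⟨U, hU⟩ := s7_unitary (fun i : unitInterval × Fin m => e i.1 (v i.2))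
    (fun i : unitInterval × Fin m => f i.1 (w i.2)) htv htw (fun i j => by rw [hv, hw])
  have hUe : ∀ t x, U (e t x) = f t (U x) := by
    intro t
    have hd := Submodule.dense_iff_topologicalClosure_eq_top.2 htv
    have h1 : (U.toLinearIsometry.toContinuousLinearMap ∘L e t) =
        (f t ∘L U.toLinearIsometry.toContinuousLinearMap) := by
      refine ContinuousLinearMap.ext_on hd ?_
      rintro _ ⟨⟨s, j⟩, rfl⟩
      change U (e t (e s (v j))) = f t (U (e s (v j)))
      have h2 : e t (e s (v j)) = e (min t s) (v j) := congr($(he t s) (v j))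
      have h3 : f t (f s (w j)) = f (min t s) (w j) := congr($(hf t s) (w j))
      rw [h2, hU (min t s, j), hU (s, j), h3]
    intro x
    exact congr($h1 x)
  have hUf : ∀ t y, U.symm (f t y) = e t (U.symm y) := by
    intro t y
    apply U.injective
    rw [hUe]; simp
  refine ⟨U, fun T => ?_⟩
  rw [hM1, hM2]
  constructor
  · intro h S hS
    have h1 := h (U.symm.toLinearIsometry.toContinuousLinearMap ∘L S ∘L
      U.toLinearIsometry.toContinuousLinearMap) (by
        intro t
        ext x
        change U.symm (S (U (e t x))) = e t (U.symm (S (U x)))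
        have h2 : S (f t (U x)) = f t (S (U x)) := congr($(hS t) (U x))
        rw [hUe, h2, hUf])
    ext y
    have h3 : U.symm (S (U (T (U.symm y)))) = T (U.symm (S (U (U.symm y)))) := congr($h1 (U.symm y))
    rw [LinearIsometryEquiv.apply_symm_apply] at h3
    change S (U (T (U.symm y))) = U (T (U.symm (S y)))
    rw [← h3, LinearIsometryEquiv.apply_symm_apply]
  · intro h S hS
    have h1 := h (U.toLinearIsometry.toContinuousLinearMap ∘L S ∘L
      U.symm.toLinearIsometry.toContinuousLinearMap) (by
        intro t
        ext x
        change U (S (U.symm (f t x))) = f t (U (S (U.symm x)))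
        have h2 : S (e t (U.symm x)) = e t (S (U.symm x)) := congr($(hS t) (U.symm x))
        rw [hUf, h2, hUe])
    ext x
    have h3 : U (S (U.symm (U (T (U.symm (U x)))))) = U (T (U.symm (U (S (U.symm (U x)))))) :=
      congr($h1 (U x))
    simp only [LinearIsometryEquiv.symm_apply_apply] at h3
    exact U.injective h3
end
end

section
/- Let H be an infinite-dimensional separable complex Hilbert space and M a commutative von Neumann subalgebra of the bounded operators on H which contains no minimal projection and which admits a unit vector ξ ∈ H that is cyclic (the closure of Mξ is H) and separating (xξ = 0 implies x = 0 for x ∈ M). Then there exists a unitary operator U : H → L²([0,1], Lebesgue measure; ℂ) such that U M U* is exactly the algebra of multiplication operators by (equivalence classes of) bounded measurable functions on [0,1]. -/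
noncomputable section

open MeasureTheory

open ProbabilityTheory Filter Topology

lemma cdf_cont (ν : Measure ℝ) [IsProbabilityMeasure ν] (hν : ∀ x, ν {x} = 0) :
    Continuous (cdf ν) := by
  rw [continuous_iff_continuousAt]
  intro x
  rw [(monotone_cdf ν).continuousAt_iff_leftLim_eq_rightLim, (cdf ν).rightLim_eq]
  have h := (cdf ν).measure_singleton x
  rw [measure_cdf, hν] at h
  have h1 := (ENNReal.ofReal_eq_zero.mp h.symm)
  exact le_antisymm ((monotone_cdf ν).leftLim_le le_rfl) (by linarith)

lemma measure_cdf_le (ν : Measure ℝ) [IsProbabilityMeasure ν] (hν : ∀ x, ν {x} = 0)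
    {t : ℝ} (h0 : 0 ≤ t) (h1 : t ≤ 1) : ν {x | cdf ν x ≤ t} = ENNReal.ofReal t := by
  have hc := cdf_cont ν hν
  have ivt : ∀ s, 0 < s → s < 1 → ∃ a, cdf ν a = s := by
    intro s hs0 hs1
    have := mem_range_of_exists_le_of_exists_ge hc
      (((tendsto_cdf_atBot ν).eventually (eventually_le_nhds hs0)).exists)
      (((tendsto_cdf_atTop ν).eventually (eventually_ge_nhds hs1)).exists)
    exact this
  apply le_antisymm
  · rcases eq_or_lt_of_le h1 with h1 | h1
    · subst h1; simpa using prob_le_one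
    · apply le_of_forall_gt_imp_ge_of_dense
      intro b hb
      rcases le_or_gt 1 b with hb1 | hb1
      · exact prob_le_one.trans hb1
      · have hbt : b ≠ ⊤ := (hb1.trans ENNReal.one_lt_top).ne
        have hb' : t < b.toReal := (ENNReal.ofReal_lt_iff_lt_toReal h0 hbt).mp hb
        have hb1' : b.toReal < 1 := by
          simpa using (ENNReal.toReal_lt_toReal hbt ENNReal.one_ne_top).mpr hb1
        obtain ⟨a, ha⟩ := ivt b.toReal (by linarith) hb1'
        calc ν {x | cdf ν x ≤ t} ≤ ν (Set.Iic a) := by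
              apply measure_mono
              intro x hx
              by_contra hxa
              have : cdf ν a ≤ cdf ν x := monotone_cdf ν (le_of_lt (by simpa using hxa))
              have hx' : cdf ν x ≤ t := hx
              linarith
          _ = b := by rw [← ofReal_cdf, ha, ENNReal.ofReal_toReal hbt]
  · rcases eq_or_lt_of_le h0 with h0 | h0
    · subst h0; simp
    · rcases eq_or_lt_of_le h1 with h1 | h1
      · subst h1
        have : {x | cdf ν x ≤ 1} = Set.univ := by ext x; simp [cdf_le_one]
        simp [this]
      · obtain ⟨a, ha⟩ := ivt t h0 h1
        rw [← ha, ofReal_cdf]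
        exact measure_mono fun x hx => monotone_cdf ν hx

lemma cdf_mp (ν : Measure ℝ) [IsProbabilityMeasure ν] (hν : ∀ x, ν {x} = 0) :
    MeasurePreserving (cdf ν) ν ((volume : Measure ℝ).restrict (Set.Icc 0 1)) := by
  have hm : Measurable (cdf ν) := (monotone_cdf ν).measurable
  refine ⟨hm, ?_⟩
  have : IsProbabilityMeasure (ν.map (cdf ν)) := Measure.isProbabilityMeasure_map hm.aemeasurable
  refine Measure.ext_of_Iic _ _ fun t => ?_
  rw [Measure.map_apply hm measurableSet_Iic, Measure.restrict_apply measurableSet_Iic]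
  rcases lt_or_ge t 0 with h0 | h0
  · have e1 : cdf ν ⁻¹' Set.Iic t = ∅ := by
      ext x; simpa using h0.trans_le (cdf_nonneg ν x)
    have e2 : Set.Iic t ∩ Set.Icc 0 1 = ∅ := by
      ext x; simp; intro h h'; linarith
    rw [e1, e2]; simp
  · rcases le_or_gt t 1 with h1 | h1
    · have e2 : Set.Iic t ∩ Set.Icc 0 1 = Set.Icc 0 t := by
        ext x; simp; constructor
        · rintro ⟨a, b, c⟩; exact ⟨b, a⟩
        · rintro ⟨a, b⟩; exact ⟨b, a, b.trans h1⟩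
      rw [e2, Real.volume_Icc, sub_zero]
      exact measure_cdf_le ν hν h0 h1
    · have e1 : cdf ν ⁻¹' Set.Iic t = Set.univ := by
        ext x; simpa using (cdf_le_one ν x).trans h1.le
      have e2 : Set.Iic t ∩ Set.Icc 0 1 = Set.Icc 0 1 := by
        ext x; simp; intro _ h; linarith
      rw [e1, e2]; simp

lemma cdf_inv (ν : Measure ℝ) [IsProbabilityMeasure ν] (hν : ∀ x, ν {x} = 0)
    (g : ℝ → ℂ) (hg : Measurable g) :
    ∃ g' : ℝ → ℂ, Measurable g' ∧ ∀ᵐ x ∂ν, g' (cdf ν x) = g x := by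
  have hm : Measurable (cdf ν) := (monotone_cdf ν).measurable
  let B : ℚ → Set ℝ := fun q => {x | cdf ν x ≤ cdf ν q} \ Set.Iic (q : ℝ)
  have hBm : ∀ q, MeasurableSet (B q) := fun q =>
    (measurableSet_le hm measurable_const).diff measurableSet_Iic
  have hB : ∀ q, ν (B q) = 0 := by
    intro q
    have hsub : Set.Iic (q : ℝ) ⊆ {x | cdf ν x ≤ cdf ν q} := fun x hx => monotone_cdf ν hx
    rw [measure_sdiff hsub measurableSet_Iic.nullMeasurableSet (measure_ne_top _ _),
      measure_cdf_le ν hν (cdf_nonneg _ _) (cdf_le_one _ _), ofReal_cdf, tsub_self]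
  let N : Set ℝ := ⋃ q, B q
  have hN : ν N = 0 := measure_iUnion_null hB
  have hNm : MeasurableSet N := MeasurableSet.iUnion hBm
  have hinj : ∀ x y : ℝ, y ∉ N → x < y → cdf ν x ≠ cdf ν y := by
    intro x y hy hxy he
    obtain ⟨q, hq1, hq2⟩ := exists_rat_btwn hxy
    apply hy
    refine Set.mem_iUnion.mpr ⟨q, ?_, by simpa using hq2⟩
    show cdf ν y ≤ cdf ν q
    rw [← he]; exact monotone_cdf ν hq1.le
  have : StandardBorelSpace ↥(Nᶜ) := hNm.compl.standardBorel
  have hme : MeasurableEmbedding (fun x : ↥(Nᶜ) => cdf ν x) := by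
    apply Measurable.measurableEmbedding (hm.comp measurable_subtype_coe)
    intro x y hxy
    rcases lt_trichotomy x.1 y.1 with h | h | h
    · exact absurd hxy (hinj _ _ y.2 h)
    · exact Subtype.ext h
    · exact absurd hxy.symm (hinj _ _ x.2 h)
  obtain ⟨g', hg', he⟩ := hme.exists_measurable_extend (hg.comp measurable_subtype_coe)
    (fun _ => inferInstance)
  refine ⟨g', hg', ?_⟩
  have : ∀ᵐ x ∂ν, x ∉ N := measure_eq_zero_iff_ae_notMem.mp hN
  filter_upwards [this] with x hx
  exact congrFun he ⟨x, hx⟩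

section L2tools
variable {X : Type*} [MeasurableSpace X] {μ : Measure X}

lemma l2_norm_sq (f : Lp ℂ 2 μ) : ‖f‖ ^ 2 = ∫ x, ‖f x‖ ^ 2 ∂μ := by
  have h := L2.inner_def (𝕜 := ℂ) f f
  rw [inner_self_eq_norm_sq_to_K] at h
  have h2 : ∀ x, inner ℂ (f x) (f x) = ((‖f x‖ ^ 2 : ℝ) : ℂ) := fun x => by
    rw [inner_self_eq_norm_sq_to_K]; norm_cast
  simp_rw [h2] at h
  rw [integral_complex_ofReal] at h
  rw [← RCLike.ofReal_pow] at h
  exact Complex.ofReal_injective h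

lemma mulOp_exists (h : X → ℂ) (hm : Measurable h) (c : ℝ) (hc : ∀ x, ‖h x‖ ≤ c) :
    ∃ S : Lp ℂ 2 μ →L[ℂ] Lp ℂ 2 μ, ∀ g : Lp ℂ 2 μ, S g =ᵐ[μ] fun x => h x * g x := by
  have hL : MemLp h ⊤ μ := memLp_top_of_bound hm.aestronglyMeasurable c (Eventually.of_forall hc)
  refine ⟨(ContinuousLinearMap.mul ℂ ℂ).holderL μ ⊤ 2 2 hL.toLp, fun g => ?_⟩
  have h1 := (ContinuousLinearMap.mul ℂ ℂ).coeFn_holder (r := 2) hL.toLp g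
  filter_upwards [h1, hL.coeFn_toLp] with x hx hx2
  rw [← hx2]
  exact hx

lemma mul_closed [IsFiniteMeasure μ] (S : Lp ℂ 2 μ →L[ℂ] Lp ℂ 2 μ) (h0 : Lp ℂ 2 μ)
    {ι : Type*} (D : ι → Lp ℂ 2 μ) (hD : DenseRange D)
    (h : ∀ i, S (D i) =ᵐ[μ] fun x => h0 x * D i x) (g : Lp ℂ 2 μ) :
    S g =ᵐ[μ] fun x => h0 x * g x := by
  have hone : MemLp (fun _ : X => (1 : ℂ)) 2 μ := memLp_const 1
  let m := (ContinuousLinearMap.mul ℂ ℂ).holderL μ 2 2 1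
  have hm : ∀ a b : Lp ℂ 2 μ, m a b =ᵐ[μ] fun x => a x * b x := fun a b =>
    (ContinuousLinearMap.mul ℂ ℂ).coeFn_holder (r := 1) a b
  have key : ∀ g : Lp ℂ 2 μ, m hone.toLp (S g) = m h0 g ↔ S g =ᵐ[μ] fun x => h0 x * g x := by
    intro g
    constructor
    · intro he
      filter_upwards [hm hone.toLp (S g), hm h0 g, hone.coeFn_toLp] with x h1 h2 h3
      rw [← h2, ← he, h1, h3, one_mul]
    · intro he
      apply Lp.ext
      filter_upwards [hm hone.toLp (S g), hm h0 g, hone.coeFn_toLp, he] with x h1 h2 h3 h4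
      rw [h2, ← h4, h1, h3, one_mul]
  rw [← key]
  refine isClosed_property hD (p := fun g => m hone.toLp (S g) = m h0 g) (isClosed_eq ?_ ?_) (fun i => (key _).mpr (h i)) g
  · exact (m hone.toLp).continuous.comp S.continuous
  · exact (m h0).continuous

lemma mul_bdd [IsFiniteMeasure μ] (S : Lp ℂ 2 μ →L[ℂ] Lp ℂ 2 μ) (h0 : Lp ℂ 2 μ)
    (h : ∀ g : Lp ℂ 2 μ, S g =ᵐ[μ] fun x => h0 x * g x) :
    ∃ h : X → ℂ, Measurable h ∧ (∀ x, ‖h x‖ ≤ ‖S‖) ∧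
      ∀ g : Lp ℂ 2 μ, S g =ᵐ[μ] fun x => h x * g x := by
  have hm0 : Measurable (h0 : X → ℂ) := (Lp.stronglyMeasurable h0).measurable
  let E : Set X := {x | ‖S‖ < ‖h0 x‖}
  have hE : MeasurableSet E := measurableSet_lt measurable_const hm0.norm
  have hE0 : μ E = 0 := by
    let e : Lp ℂ 2 μ := indicatorConstLp 2 hE (measure_ne_top μ E) (1 : ℂ)
    have he : e =ᵐ[μ] E.indicator fun _ => (1 : ℂ) := indicatorConstLp_coeFn
    have h1 : ‖S e‖ ^ 2 ≤ ‖S‖ ^ 2 * ‖e‖ ^ 2 := by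
      rw [← mul_pow]
      exact pow_le_pow_left₀ (norm_nonneg _) (S.le_opNorm e) 2
    have i1 : IntegrableOn (fun x => ‖h0 x‖ ^ 2) E μ :=
      ((memLp_two_iff_integrable_sq_norm (Lp.aestronglyMeasurable h0)).mp (Lp.memLp h0)).integrableOn
    have i2 : IntegrableOn (fun _ : X => ‖S‖ ^ 2) E μ := integrableOn_const (measure_ne_top _ _)
    have h2 : ‖S e‖ ^ 2 = ∫ x in E, ‖h0 x‖ ^ 2 ∂μ := by
      rw [l2_norm_sq, ← integral_indicator hE]
      apply integral_congr_ae
      filter_upwards [h e, he] with x a b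
      rw [a, b]
      by_cases hx : x ∈ E <;> simp [hx]
    have h3 : ‖S‖ ^ 2 * ‖e‖ ^ 2 = ∫ x in E, ‖S‖ ^ 2 ∂μ := by
      rw [l2_norm_sq, ← integral_indicator hE, ← integral_const_mul]
      apply integral_congr_ae
      filter_upwards [he] with x b
      rw [b]
      by_cases hx : x ∈ E <;> simp [hx]
    rw [h2, h3, ← sub_nonpos, ← integral_sub i1 i2] at h1
    have hpos : ∀ x ∈ E, 0 < ‖h0 x‖ ^ 2 - ‖S‖ ^ 2 := fun x hx => by
      have hx' : ‖S‖ < ‖h0 x‖ := hx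
      have := norm_nonneg S
      nlinarith
    have h4 : ∫ x in E, (‖h0 x‖ ^ 2 - ‖S‖ ^ 2) ∂μ = 0 :=
      le_antisymm h1 (setIntegral_nonneg hE fun x hx => (hpos x hx).le)
    rw [setIntegral_eq_zero_iff_of_nonneg_ae
      ((ae_restrict_iff' hE).mpr (Eventually.of_forall fun x hx => (hpos x hx).le)) (i1.sub i2),
      EventuallyEq, ae_restrict_iff' hE] at h4
    rw [measure_eq_zero_iff_ae_notMem]
    filter_upwards [h4] with x hx hxE
    exact (hpos x hxE).ne' (hx hxE)
  refine ⟨Eᶜ.indicator h0, hm0.indicator hE.compl, fun x => ?_, fun g => ?_⟩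
  · by_cases hx : x ∈ E
    · simp [hx]
    · simp [hx]; simpa [E] using hx
  · filter_upwards [h g, measure_eq_zero_iff_ae_notMem.mp hE0] with x a b
    rw [a]; simp [b]

end L2tools

lemma exists_theta {X : Type*} [MeasurableSpace X] {μ : Measure X} [IsProbabilityMeasure μ]
    [TopologicalSpace.SeparableSpace (Lp ℂ 2 μ)]
    (hat : ∀ E : Set X, MeasurableSet E → μ E ≠ 0 → ∀ P : Lp ℂ 2 μ →L[ℂ] Lp ℂ 2 μ,
      (∀ g : Lp ℂ 2 μ, P g =ᵐ[μ] fun x => E.indicator (fun _ => (1 : ℂ)) x * g x) →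
      ¬ ∃ e0 : Lp ℂ 2 μ, ∀ f, ∃ c : ℂ, P f = c • e0) :
    ∃ (Θ : X → ℝ) (hΘ : MeasurePreserving Θ μ ((volume : Measure ℝ).restrict (Set.Icc 0 1))),
      Function.Surjective (Lp.compMeasurePreservingₗᵢ (E := ℂ) (p := 2) ℂ Θ hΘ) := by
  let f : ℕ → Lp ℂ 2 μ := TopologicalSpace.denseSeq _
  have hf : DenseRange f := TopologicalSpace.denseRange_denseSeq _
  have hfm : ∀ n, Measurable (f n : X → ℂ) := fun n => (Lp.stronglyMeasurable (f n)).measurable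
  let e : (ℕ → ℂ) → ℝ := embeddingReal (ℕ → ℂ)
  have he : MeasurableEmbedding e := measurableEmbedding_embeddingReal _
  let Ψ : X → ℝ := fun x => e fun n => f n x
  have hΨ : Measurable Ψ := he.measurable.comp (measurable_pi_lambda _ hfm)
  let ν := μ.map Ψ
  have hνp : IsProbabilityMeasure ν := Measure.isProbabilityMeasure_map hΨ.aemeasurable
  have hν : ∀ y, ν {y} = 0 := by
    intro y
    by_contra hy
    rw [Measure.map_apply hΨ (measurableSet_singleton y)] at hy
    let E : Set X := Ψ ⁻¹' {y}
    have hE : MeasurableSet E := hΨ (measurableSet_singleton y)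
    obtain ⟨P, hP⟩ := mulOp_exists (μ := μ) (E.indicator fun _ => (1 : ℂ))
      (measurable_const.indicator hE) 1 (fun x => by
        by_cases hx : x ∈ E <;> simp [hx])
    refine hat E hE hy P hP ⟨indicatorConstLp 2 hE (measure_ne_top μ E) (1 : ℂ), ?_⟩
    set e0 : Lp ℂ 2 μ := indicatorConstLp 2 hE (measure_ne_top μ E) (1 : ℂ) with he0
    have he0' : e0 =ᵐ[μ] E.indicator fun _ => (1 : ℂ) := indicatorConstLp_coeFn
    have hcl : ∀ g, P g ∈ Submodule.span ℂ {e0} := by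
      intro g
      refine isClosed_property hf (p := fun g => P g ∈ Submodule.span ℂ {e0}) ?_ ?_ g
      · exact (Submodule.closed_of_finiteDimensional _).preimage P.continuous
      · intro n
        have hne : E.Nonempty := nonempty_of_measure_ne_zero hy
        obtain ⟨x0, hx0⟩ := hne
        refine Submodule.mem_span_singleton.mpr ⟨f n x0, ?_⟩
        apply Lp.ext
        filter_upwards [hP (f n), Lp.coeFn_smul (f n x0) e0, he0'] with x h1 h2 h3
        rw [h1, h2, Pi.smul_apply, h3]
        by_cases hx : x ∈ E
        · have : Ψ x = Ψ x0 := by rw [show Ψ x = y from hx, show Ψ x0 = y from hx0]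
          have := congrFun (he.injective this) n
          simp [hx]; exact this.symm
        · simp [hx]
    intro g
    obtain ⟨c, hc⟩ := Submodule.mem_span_singleton.mp (hcl g)
    exact ⟨c, hc.symm⟩
  have hΨp : MeasurePreserving Ψ μ ν := ⟨hΨ, rfl⟩
  have hΘ := (cdf_mp ν hν).comp hΨp
  refine ⟨_, hΘ, ?_⟩
  set C := Lp.compMeasurePreservingₗᵢ (E := ℂ) (p := 2) ℂ _ hΘ with hC
  have hcl : IsClosed (Set.range C) := C.isometry.isClosedEmbedding.isClosed_range
  have hsub : Set.range f ⊆ Set.range C := by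
    rintro _ ⟨n, rfl⟩
    obtain ⟨k, hk, hke⟩ := he.exists_measurable_extend
      (g := fun z : ℕ → ℂ => z n) (measurable_pi_apply n) (fun _ => inferInstance)
    obtain ⟨g, hg, hge⟩ := cdf_inv ν hν k hk
    have hae : ∀ᵐ x ∂μ, g (cdf ν (Ψ x)) = f n x := by
      filter_upwards [hΨp.quasiMeasurePreserving.ae hge] with x hx
      rw [hx]
      exact congrFun hke _
    have hgL : MemLp g 2 ((volume : Measure ℝ).restrict (Set.Icc 0 1)) := by
      rw [← hΘ.map_eq, memLp_map_measure_iff hg.aestronglyMeasurable hΘ.measurable.aemeasurable]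
      exact (memLp_congr_ae hae).mpr (Lp.memLp (f n))
    refine ⟨hgL.toLp, ?_⟩
    have : C hgL.toLp = (hgL.comp_measurePreserving hΘ).toLp := Lp.toLp_compMeasurePreserving hgL hΘ
    rw [this]
    apply Lp.ext
    filter_upwards [MemLp.coeFn_toLp (hgL.comp_measurePreserving hΘ), hae] with x h1 h2
    rw [h1]; exact h2
  rw [← Set.range_eq_univ]
  exact Set.univ_subset_iff.mp (hf.closure_eq ▸ closure_minimal hsub hcl)

section spectral
variable {H : Type*} [NormedAddCommGroup H] [InnerProductSpace ℂ H] [CompleteSpace H]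
  {X : Type*} [TopologicalSpace X] [CompactSpace X] [T2Space X] [MeasurableSpace X] [BorelSpace X]

open CompactlySupported

def ccToC : C_c(X, ℝ) →ₗ[ℝ] C(X, ℂ) where
  toFun f := ⟨fun x => (f x : ℂ), Complex.continuous_ofReal.comp f.continuous⟩
  map_add' f g := by ext x; simp
  map_smul' c f := by ext x; simp

lemma rho_norm_sq (ρ : C(X, ℂ) →⋆ₐ[ℂ] (H →L[ℂ] H)) (ξ : H) (f : C(X, ℂ)) :
    (inner ℂ ξ (ρ (star f * f) ξ)).re = ‖ρ f ξ‖ ^ 2 := by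
  rw [map_mul, map_star, mul_apply_eq_comp, ContinuousLinearMap.star_eq_adjoint,
    ContinuousLinearMap.adjoint_inner_right, inner_self_eq_norm_sq_to_K]
  norm_cast

lemma exists_measure (ρ : C(X, ℂ) →⋆ₐ[ℂ] (H →L[ℂ] H)) (ξ : H) :
    ∃ μ : Measure X, μ.Regular ∧ IsFiniteMeasure μ ∧
      ∀ f : C(X, ℂ), ∫ x, ‖f x‖ ^ 2 ∂μ = ‖ρ f ξ‖ ^ 2 := by
  let L : C_c(X, ℝ) →ₗ[ℝ] ℝ :=
    { toFun := fun f => (inner ℂ ξ (ρ (ccToC f) ξ)).re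
      map_add' := fun f g => by simp
      map_smul' := fun c f => by
        have : ccToC (c • f) = (c : ℂ) • ccToC f := by ext x; simp [ccToC]
        rw [this, map_smul, smul_apply, inner_smul_right]
        simp }
  have hL : ∀ f, 0 ≤ f → 0 ≤ L f := by
    intro f hf
    let r : C(X, ℂ) := ⟨fun x => (Real.sqrt (f x) : ℂ),
      Complex.continuous_ofReal.comp (Real.continuous_sqrt.comp f.continuous)⟩
    have : ccToC f = star r * r := by
      ext x
      have hx : 0 ≤ f x := hf x
      have := Real.mul_self_sqrt hx
      simp only [ccToC, r, LinearMap.coe_mk, AddHom.coe_mk, ContinuousMap.coe_mk,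
        ContinuousMap.mul_apply, ContinuousMap.star_apply, RCLike.star_def, Complex.conj_ofReal]
      rw [← Complex.ofReal_mul, this]
    show 0 ≤ (inner ℂ ξ (ρ (ccToC f) ξ)).re
    rw [this, rho_norm_sq]
    positivity
  let Λ : C_c(X, ℝ) →ₚ[ℝ] ℝ := PositiveLinearMap.mk₀ L hL
  refine ⟨RealRMK.rieszMeasure Λ, inferInstance, inferInstance, fun f => ?_⟩
  let F : C_c(X, ℝ) := ⟨⟨fun x => ‖f x‖ ^ 2, by fun_prop⟩, HasCompactSupport.of_compactSpace _⟩
  have h := RealRMK.integral_rieszMeasure Λ F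
  have hF : ccToC F = star f * f := by
    ext x
    simp only [ccToC, F, LinearMap.coe_mk, AddHom.coe_mk, ContinuousMap.coe_mk,
      CompactlySupportedContinuousMap.coe_mk,
        ContinuousMap.mul_apply, ContinuousMap.star_apply, RCLike.star_def]
    rw [Complex.conj_mul']
    norm_cast
  calc _ = Λ F := h
    _ = (inner ℂ ξ (ρ (ccToC F) ξ)).re := rfl
    _ = _ := by rw [hF, rho_norm_sq]

lemma exists_V (ρ : C(X, ℂ) →⋆ₐ[ℂ] (H →L[ℂ] H)) (ξ : H) (hd : DenseRange fun f => ρ f ξ) :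
    ∃ μ : Measure X, μ.Regular ∧ IsFiniteMeasure μ ∧ ∃ V : Lp ℂ 2 μ ≃ₗᵢ[ℂ] H,
      DenseRange (fun f : C(X, ℂ) => V.symm (ρ f ξ)) ∧
      ∀ f : C(X, ℂ), V.symm (ρ f ξ) =ᵐ[μ] f := by
  obtain ⟨μ, hr, hfin, hμ⟩ := exists_measure ρ ξ
  refine ⟨μ, hr, hfin, ?_⟩
  let J : C(X, ℂ) →L[ℂ] Lp ℂ 2 μ := ContinuousMap.toLp 2 μ ℂ
  have hJd : DenseRange J := ContinuousMap.toLp_denseRange ℂ μ ℂ (by norm_num)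
  have hJ : ∀ f, J f =ᵐ[μ] f := fun f => ContinuousMap.coeFn_toLp μ f
  let R : C(X, ℂ) →ₗ[ℂ] H :=
    { toFun := fun f => ρ f ξ
      map_add' := fun f g => by simp
      map_smul' := fun c f => by simp }
  have hn : ∀ f, ‖R f‖ = ‖J f‖ := by
    intro f
    have : ‖R f‖ ^ 2 = ‖J f‖ ^ 2 := by
      rw [l2_norm_sq]
      refine (hμ f).symm.trans (integral_congr_ae ?_)
      filter_upwards [hJ f] with x hx
      rw [hx]
    exact (pow_left_inj₀ (norm_nonneg _) (norm_nonneg _) two_ne_zero).mp this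
  let V0 : Lp ℂ 2 μ →L[ℂ] H := R.extendOfNorm J.toLinearMap
  have hV0 : ∀ f, V0 (J f) = R f := fun f =>
    LinearMap.extendOfNorm_eq hJd ⟨1, fun g => by rw [one_mul]; exact (hn g).le⟩ f
  have hiso : ∀ g, ‖V0 g‖ = ‖g‖ := by
    intro g
    refine isClosed_property hJd (p := fun g => ‖V0 g‖ = ‖g‖)
      (isClosed_eq V0.continuous.norm continuous_norm) (fun f => ?_) g
    rw [hV0, hn]
  let V1 : Lp ℂ 2 μ →ₗᵢ[ℂ] H := ⟨V0.toLinearMap, hiso⟩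
  have hsurj : Function.Surjective V1 := by
    have hcl : IsClosed (Set.range V1) := V1.isometry.isClosedEmbedding.isClosed_range
    rw [← Set.range_eq_univ]
    refine Set.univ_subset_iff.mp (hd.closure_eq ▸ closure_minimal ?_ hcl)
    rintro _ ⟨f, rfl⟩
    exact ⟨J f, hV0 f⟩
  let V := LinearIsometryEquiv.ofSurjective V1 hsurj
  have hV : ∀ f, V.symm (ρ f ξ) = J f := by
    intro f
    rw [LinearIsometryEquiv.symm_apply_eq]
    exact (hV0 f).symm
  refine ⟨V, ?_, fun f => ?_⟩
  · simp_rw [hV]; exact hJd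
  · rw [hV]; exact hJ f

end spectral

section vn
variable {H : Type} [NormedAddCommGroup H] [InnerProductSpace ℂ H] [CompleteSpace H]

lemma exists_rho (M : VonNeumannAlgebra H) (hcomm : ∀ a ∈ M, ∀ b ∈ M, a * b = b * a) :
    ∃ (X : Type) (_ : TopologicalSpace X) (_ : CompactSpace X) (_ : T2Space X)
      (ρ : C(X, ℂ) →⋆ₐ[ℂ] (H →L[ℂ] H)), ∀ T, T ∈ M ↔ ∃ f, ρ f = T := by
  let N := M.toStarSubalgebra
  have hcl : IsClosed (N : Set (H →L[ℂ] H)) := by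
    have : (N : Set (H →L[ℂ] H)) = Set.centralizer (Set.centralizer M) := by
      rw [VonNeumannAlgebra.centralizer_centralizer]; rfl
    rw [this]
    exact Set.isClosed_centralizer _
  let iC : CStarAlgebra N := inferInstance
  let i : CommCStarAlgebra N :=
    { iC with mul_comm := fun a b => Subtype.ext (hcomm a a.2 b b.2) }
  let G := gelfandStarTransform N
  refine ⟨WeakDual.characterSpace ℂ N, inferInstance, inferInstance, inferInstance,
    N.subtype.comp (G.symm : _ →⋆ₐ[ℂ] _), fun T => ⟨fun hT => ⟨G ⟨T, hT⟩, ?_⟩, ?_⟩⟩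
  · show ((G.symm (G ⟨T, hT⟩) : N) : H →L[ℂ] H) = T
    rw [StarAlgEquiv.symm_apply_apply]
  · rintro ⟨f, rfl⟩
    exact (G.symm f).2

lemma mem_iff_mult {X : Type} [TopologicalSpace X] [MeasurableSpace X]
    (M : VonNeumannAlgebra H) (hcomm : ∀ a ∈ M, ∀ b ∈ M, a * b = b * a)
    (ρ : C(X, ℂ) →⋆ₐ[ℂ] (H →L[ℂ] H)) (hρ : ∀ T, T ∈ M ↔ ∃ f, ρ f = T) (ξ : H)
    (μ : Measure X) [IsFiniteMeasure μ] (V : Lp ℂ 2 μ ≃ₗᵢ[ℂ] H)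
    (hD : DenseRange (fun f : C(X, ℂ) => V.symm (ρ f ξ)))
    (hV : ∀ f : C(X, ℂ), V.symm (ρ f ξ) =ᵐ[μ] f) (T : H →L[ℂ] H) :
    T ∈ M ↔ ∃ h : X → ℂ, Measurable h ∧ (∃ c : ℝ, ∀ x, ‖h x‖ ≤ c) ∧
      ∀ g : Lp ℂ 2 μ, V.symm (T (V g)) =ᵐ[μ] fun x => h x * g x := by
  let conj : (H →L[ℂ] H) → (Lp ℂ 2 μ →L[ℂ] Lp ℂ 2 μ) := fun T =>
    (V.symm.toContinuousLinearEquiv : H →L[ℂ] Lp ℂ 2 μ) ∘L T ∘L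
      (V.toContinuousLinearEquiv : Lp ℂ 2 μ →L[ℂ] H)
  have hconj : ∀ T g, conj T g = V.symm (T (V g)) := fun T g => rfl
  have hρm : ∀ (f : C(X, ℂ)) (g : Lp ℂ 2 μ), conj (ρ f) g =ᵐ[μ] fun x => f x * g x := by
    intro f g
    have := mul_closed (conj (ρ f)) (V.symm (ρ f ξ)) _ hD (fun k => by
      have h1 : conj (ρ f) (V.symm (ρ k ξ)) = V.symm (ρ (f * k) ξ) := by
        rw [hconj, V.apply_symm_apply, map_mul]; rfl
      rw [h1]
      filter_upwards [hV (f * k), hV f, hV k] with x a b c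
      rw [a, b, c]; rfl) g
    filter_upwards [this, hV f] with x a b
    rw [a, b]
  have key : ∀ T : H →L[ℂ] H, (∀ a ∈ M, a * T = T * a) →
      ∃ h : X → ℂ, Measurable h ∧ (∃ c : ℝ, ∀ x, ‖h x‖ ≤ c) ∧
      ∀ g : Lp ℂ 2 μ, V.symm (T (V g)) =ᵐ[μ] fun x => h x * g x := by
    intro T hT
    have h1 := mul_closed (conj T) (V.symm (T ξ)) _ hD (fun k => by
      have h1 : conj T (V.symm (ρ k ξ)) = conj (ρ k) (V.symm (T ξ)) := by
        rw [hconj, hconj, V.apply_symm_apply, V.apply_symm_apply]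
        have := hT (ρ k) ((hρ _).mpr ⟨k, rfl⟩)
        exact congrArg V.symm (congrArg (fun A : H →L[ℂ] H => A ξ) this).symm
      rw [h1]
      filter_upwards [hρm k (V.symm (T ξ)), hV k] with x a b
      rw [a, b, mul_comm])
    obtain ⟨h, hm, hb, hh⟩ := mul_bdd _ _ h1
    exact ⟨h, hm, ⟨_, hb⟩, hh⟩
  constructor
  · intro hT
    exact key T fun a ha => hcomm a ha T hT
  · rintro ⟨h, hm, -, hh⟩
    rw [← VonNeumannAlgebra.commutant_commutant M, VonNeumannAlgebra.mem_commutant_iff]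
    intro A hA
    rw [VonNeumannAlgebra.mem_commutant_iff] at hA
    obtain ⟨k, -, -, hk⟩ := key A hA
    ext v
    apply V.symm.injective
    obtain ⟨g, rfl⟩ := V.surjective v
    apply Lp.ext
    have e1 := hk (V.symm (T (V g)))
    have e2 := hh (V.symm (A (V g)))
    rw [V.apply_symm_apply] at e1 e2
    filter_upwards [e1, e2, hh g, hk g] with x a b c d
    rw [mul_apply_eq_comp, mul_apply_eq_comp, a, b, c, d]
    ring

lemma no_atom {X : Type} [MeasurableSpace X]
    (M : VonNeumannAlgebra H) (hcomm : ∀ a ∈ M, ∀ b ∈ M, a * b = b * a)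
    (hmin : HasNoMinimalProjection M)
    (μ : Measure X) [IsFiniteMeasure μ] (V : Lp ℂ 2 μ ≃ₗᵢ[ℂ] H)
    (hM : ∀ T : H →L[ℂ] H, (∃ h : X → ℂ, Measurable h ∧ (∃ c : ℝ, ∀ x, ‖h x‖ ≤ c) ∧
      ∀ g : Lp ℂ 2 μ, V.symm (T (V g)) =ᵐ[μ] fun x => h x * g x) → T ∈ M)
    (E : Set X) (hE : MeasurableSet E) (hE0 : μ E ≠ 0) (P : Lp ℂ 2 μ →L[ℂ] Lp ℂ 2 μ)
    (hP : ∀ g : Lp ℂ 2 μ, P g =ᵐ[μ] fun x => E.indicator (fun _ => (1 : ℂ)) x * g x) :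
      ¬ ∃ e0 : Lp ℂ 2 μ, ∀ f, ∃ c : ℂ, P f = c • e0 := by
  rintro ⟨e0, he0⟩
  apply hmin
  let p : H →L[ℂ] H := (V.toContinuousLinearEquiv : Lp ℂ 2 μ →L[ℂ] H) ∘L P ∘L
      (V.symm.toContinuousLinearEquiv : H →L[ℂ] Lp ℂ 2 μ)
  have hp : ∀ v, p v = V (P (V.symm v)) := fun v => rfl
  have hpM : p ∈ M := by
    apply hM
    refine ⟨E.indicator (fun _ => (1 : ℂ)), measurable_const.indicator hE, ⟨1, fun x => ?_⟩, ?_⟩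
    · by_cases hx : x ∈ E <;> simp [hx]
    · intro g
      rw [hp, V.symm_apply_apply, V.symm_apply_apply]
      exact hP g
  have hPP : ∀ g, P (P g) = P g := by
    intro g
    apply Lp.ext
    filter_upwards [hP (P g), hP g] with x a b
    rw [a, b]
    by_cases hx : x ∈ E <;> simp [hx]
  have hp0 : p ≠ 0 := by
    intro h0
    let e : Lp ℂ 2 μ := indicatorConstLp 2 hE (measure_ne_top μ E) (1 : ℂ)
    have he : e =ᵐ[μ] E.indicator fun _ => (1 : ℂ) := indicatorConstLp_coeFn
    have h1 : P e = 0 := by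
      have : p (V e) = 0 := by rw [h0]; rfl
      rw [hp, V.symm_apply_apply] at this
      exact V.map_eq_zero_iff.mp this
    apply hE0
    rw [measure_eq_zero_iff_ae_notMem]
    have h2 := hP e
    rw [h1] at h2
    filter_upwards [h2, he, Lp.coeFn_zero ℂ 2 μ] with x a b c hx
    rw [c, b] at a
    simp [hx] at a
  have hidem : IsIdempotentElem p := by
    ext v
    rw [mul_apply_eq_comp, hp, hp, V.symm_apply_apply, hPP]
  refine ⟨p, hpM, hp0, hidem, ?_, ?_⟩
  · rw [ContinuousLinearMap.isSelfAdjoint_iff_isSymmetric]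
    intro v w
    show inner ℂ (p v) w = inner ℂ v (p w)
    obtain ⟨v, rfl⟩ := V.surjective v
    obtain ⟨w, rfl⟩ := V.surjective w
    rw [hp, hp, V.symm_apply_apply, V.symm_apply_apply, V.inner_map_map, V.inner_map_map,
      L2.inner_def, L2.inner_def]
    apply integral_congr_ae
    filter_upwards [hP v, hP w] with x a b
    rw [a, b]
    by_cases hx : x ∈ E <;> simp [hx]
  · intro q hq hqi _ hqp
    have hpq : p * q = q := by rw [hcomm p hpM q hq, hqp]
    have hpc : ∀ v, ∃ c : ℂ, p v = c • V e0 := by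
      intro v
      obtain ⟨c, hc⟩ := he0 (V.symm v)
      exact ⟨c, by rw [hp, hc, map_smul]⟩
    obtain ⟨d, hd⟩ := hpc (q (V e0))
    have hqd : q = d • p := by
      ext v
      obtain ⟨c, hc⟩ := hpc v
      have e1 : q v = q (p v) := by rw [← mul_apply_eq_comp, hqp]
      have e2 : q (V e0) = d • V e0 := by
        rw [← hd, ← mul_apply_eq_comp, hpq]
      rw [e1, hc, map_smul, e2, smul_apply, hc, smul_comm]
    have hdd : (d * d - d) • p = 0 := by
      have := hqi.eq
      rw [hqd, smul_mul_smul_comm, hidem.eq] at this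
      rw [sub_smul, this, sub_self]
    rcases smul_eq_zero.mp hdd with h | h
    · have : d * (d - 1) = 0 := by rw [← h]; ring
      rcases mul_eq_zero.mp this with h | h
      · left; rw [hqd, h, zero_smul]
      · right; rw [hqd, sub_eq_zero.mp h, one_smul]
    · exact absurd h hp0

end vn

/-- **Multiplicity-one case in the proof of Theorem 3.1.** A commutative von Neumann
algebra with no minimal projection on an infinite-dimensional separable Hilbert space,
admitting a cyclic and separating unit vector, is unitarily equivalent to the algebra of
multiplication operators by bounded measurable functions on `L²([0,1], dx)`. -/
theorem stmt8 {H : Type} [NormedAddCommGroup H] [InnerProductSpace ℂ H] [CompleteSpace H]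
    (hsep : TopologicalSpace.SeparableSpace H) (hinf : ¬ FiniteDimensional ℂ H)
    (M : VonNeumannAlgebra H)
    (hcomm : ∀ a ∈ M, ∀ b ∈ M, a * b = b * a)
    (hmin : HasNoMinimalProjection M)
    (ξ : H) (hξ : ‖ξ‖ = 1)
    (hcyclic : Dense (↑(Submodule.span ℂ {v : H | ∃ T ∈ M, v = T ξ}) : Set H))
    (hseparating : ∀ T ∈ M, T ξ = 0 → T = 0) :
    ∃ U : H ≃ₗᵢ[ℂ] Lp ℂ 2 ((volume : Measure ℝ).restrict (Set.Icc 0 1)),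
      ∀ S : Lp ℂ 2 ((volume : Measure ℝ).restrict (Set.Icc 0 1)) →L[ℂ]
          Lp ℂ 2 ((volume : Measure ℝ).restrict (Set.Icc 0 1)),
        (∃ T ∈ M, ∀ v : H, S (U v) = U (T v)) ↔
          (∃ f : ℝ → ℂ, Measurable f ∧ (∃ c : ℝ, ∀ t, ‖f t‖ ≤ c) ∧
            ∀ g : Lp ℂ 2 ((volume : Measure ℝ).restrict (Set.Icc 0 1)),
              ∀ᵐ t ∂((volume : Measure ℝ).restrict (Set.Icc 0 1)),
                (S g : ℝ → ℂ) t = f t * (g : ℝ → ℂ) t) := by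
  obtain ⟨X, _, _, _, ρ, hρ⟩ := exists_rho M hcomm
  let _ : MeasurableSpace X := borel X
  have : BorelSpace X := ⟨rfl⟩
  have hd : DenseRange fun f => ρ f ξ := by
    let R : C(X, ℂ) →ₗ[ℂ] H :=
      { toFun := fun f => ρ f ξ
        map_add' := fun f g => by simp
        map_smul' := fun c f => by simp }
    refine hcyclic.mono ?_
    have : Submodule.span ℂ {v : H | ∃ T ∈ M, v = T ξ} ≤ LinearMap.range R := by
      rw [Submodule.span_le]
      rintro v ⟨T, hT, rfl⟩
      obtain ⟨f, rfl⟩ := (hρ T).mp hT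
      exact ⟨f, rfl⟩
    exact this
  obtain ⟨μ, _, _, V, hD, hV⟩ := exists_V ρ ξ hd
  have hM := mem_iff_mult M hcomm ρ hρ ξ μ V hD hV
  have hμ : IsProbabilityMeasure μ := by
    have h1 : ‖V.symm (ρ 1 ξ)‖ ^ 2 = 1 := by
      rw [V.symm.norm_map, map_one, show (1 : H →L[ℂ] H) ξ = ξ from rfl, hξ, one_pow]
    rw [l2_norm_sq] at h1
    have h2 : ∫ x, ‖V.symm (ρ 1 ξ) x‖ ^ 2 ∂μ = ∫ x, (1 : ℝ) ∂μ := by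
      apply integral_congr_ae
      filter_upwards [hV 1] with x hx
      rw [hx]; simp
    rw [h2] at h1
    simp [Measure.real] at h1
    exact ⟨(ENNReal.toReal_eq_one_iff _).mp h1⟩
  have : TopologicalSpace.SeparableSpace (Lp ℂ 2 μ) :=
    V.symm.surjective.denseRange.separableSpace V.symm.continuous
  obtain ⟨Θ, hΘ, hsurj⟩ := exists_theta (no_atom M hcomm hmin μ V fun T => (hM T).mpr)
  let C := LinearIsometryEquiv.ofSurjective _ hsurj
  have hC : ∀ g, C g =ᵐ[μ] fun x => g (Θ x) := fun g => Lp.coeFn_compMeasurePreserving g hΘ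
  refine ⟨V.symm.trans C.symm, fun S => ⟨?_, ?_⟩⟩
  · rintro ⟨T, hT, hST⟩
    obtain ⟨h, hm, ⟨c, hc⟩, hh⟩ := (hM T).mp hT
    have hSC : ∀ g, C (S g) = V.symm (T (V (C g))) := by
      intro g
      have := hST (V (C g))
      simp only [LinearIsometryEquiv.trans_apply, LinearIsometryEquiv.symm_apply_apply] at this
      rw [this, LinearIsometryEquiv.apply_symm_apply]
    have hone : MemLp (fun _ : ℝ => (1 : ℂ)) 2 ((volume : Measure ℝ).restrict (Set.Icc 0 1)) :=
      memLp_const 1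
    have hmul := fun g => mul_closed S (S hone.toLp) id denseRange_id (fun g => by
      have hpb : ∀ᵐ x ∂μ, S g (Θ x) = S hone.toLp (Θ x) * g (Θ x) := by
        have e1 := hh (C g)
        have e2 := hh (C hone.toLp)
        rw [← hSC] at e1 e2
        filter_upwards [e1, e2, hC (S g), hC (S hone.toLp), hC g, hC hone.toLp,
          hΘ.quasiMeasurePreserving.ae hone.coeFn_toLp] with x a b a1 b1 a2 b2 o
        rw [← a1, ← b1, a, b, a2, b2, o, mul_one]
      have hms : MeasurableSet {t : ℝ | S g t = S hone.toLp t * g t} :=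
        measurableSet_eq_fun (Lp.stronglyMeasurable _).measurable
          ((Lp.stronglyMeasurable _).measurable.mul (Lp.stronglyMeasurable _).measurable)
      have hfin := (ae_map_iff hΘ.measurable.aemeasurable hms).mpr hpb
      have hmap := hΘ.map_eq
      exact hmap.ge.absolutelyContinuous.ae_le hfin) g
    obtain ⟨f, hf, hfb, hfm⟩ := mul_bdd S _ hmul
    exact ⟨f, hf, ⟨_, hfb⟩, hfm⟩
  · rintro ⟨f, hf, ⟨c, hc⟩, hfm⟩
    let T : H →L[ℂ] H := (V.toContinuousLinearEquiv : Lp ℂ 2 μ →L[ℂ] H) ∘L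
      (C.toContinuousLinearEquiv : _ →L[ℂ] Lp ℂ 2 μ) ∘L S ∘L
      (C.symm.toContinuousLinearEquiv : Lp ℂ 2 μ →L[ℂ] _) ∘L
      (V.symm.toContinuousLinearEquiv : H →L[ℂ] Lp ℂ 2 μ)
    have hT : ∀ v, T v = V (C (S (C.symm (V.symm v)))) := fun v => rfl
    refine ⟨T, (hM T).mpr ⟨fun x => f (Θ x), hf.comp hΘ.measurable, ⟨c, fun x => hc _⟩, ?_⟩, ?_⟩
    · intro g
      obtain ⟨g, rfl⟩ := C.surjective g
      rw [hT, V.symm_apply_apply, V.symm_apply_apply, C.symm_apply_apply]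
      filter_upwards [hC (S g), hC g, hΘ.quasiMeasurePreserving.ae (hfm g)] with x a b d
      rw [a, b, d]
    · intro v
      simp [hT]
end
end
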